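/- arXiv:cs/0503052 — 7 statements merged into one kernel-verified Lean document; each statement's English description precedes it below -/
import Mathlib

section
/- For every set A of positive integers, the zeta-dimension of A equals the limit superior, as n → ∞, of log|A ∩ {1, …, 2^n}| / n (where log denotes the base-2 logarithm). -/
open Filter

/-- The zeta-dimension of a set of positive integers:
`Dim_ζ(A) = inf { s ∈ [0,∞) : Σ_{n ∈ A} n^{-s} < ∞ }`. -/
noncomputable def zetaDim (A : Set ℕ+) : ℝ :=
  sInf {s : ℝ | 0 ≤ s ∧ (∑' n : A, (((n : ℕ+) : ℕ) : ENNReal) ^ (-s)) < ⊤}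

open scoped Topology

lemma ennreal_rpow_neg_anti {x y : ENNReal} {s : ℝ} (hs : 0 ≤ s) (h : x ≤ y) :
    y ^ (-s) ≤ x ^ (-s) := by
  rw [ENNReal.rpow_neg, ENNReal.rpow_neg, ENNReal.inv_le_inv]
  exact ENNReal.rpow_le_rpow h hs

/-- The number of elements of `A` up to `2 ^ n`. -/
noncomputable def dyadicCount (A : Set ℕ+) (n : ℕ) : ℕ :=
  Set.ncard {m : ℕ+ | m ∈ A ∧ (m : ℕ) ≤ 2 ^ n}

lemma finite_dyadic (A : Set ℕ+) (n : ℕ) : {m : ℕ+ | m ∈ A ∧ (m : ℕ) ≤ 2 ^ n}.Finite :=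
  ((Set.finite_Iic (2 ^ n)).preimage PNat.coe_injective.injOn).subset fun _ hm => hm.2

lemma dyadicCount_le (A : Set ℕ+) (n : ℕ) : dyadicCount A n ≤ 2 ^ n := by
  have h := Set.ncard_le_ncard_of_injOn (s := {m : ℕ+ | m ∈ A ∧ (m : ℕ) ≤ 2 ^ n})
    (t := Set.Icc 1 (2 ^ n)) (fun m : ℕ+ => (m : ℕ)) (fun m hm => ⟨m.pos, hm.2⟩)
    PNat.coe_injective.injOn (Set.finite_Icc _ _)
  simpa [dyadicCount, Set.ncard_eq_toFinset_card'] using h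

lemma logb_dyadicCount_div_nonneg (A : Set ℕ+) (n : ℕ) :
    0 ≤ Real.logb 2 (dyadicCount A n) / n := by
  refine div_nonneg ?_ n.cast_nonneg
  rcases Nat.eq_zero_or_pos (dyadicCount A n) with h | h
  · simp [h]
  · exact Real.logb_nonneg one_lt_two (by exact_mod_cast h)

lemma logb_dyadicCount_le {A : Set ℕ+} {n : ℕ} {C x : ℝ} (hC : 1 ≤ C) (hx : 0 ≤ x)
    (h : (dyadicCount A n : ℝ) ≤ C * 2 ^ x) :
    Real.logb 2 (dyadicCount A n) ≤ Real.logb 2 C + x := by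
  have hC' : 0 ≤ Real.logb 2 C := Real.logb_nonneg one_lt_two hC
  rcases Nat.eq_zero_or_pos (dyadicCount A n) with h0 | h0
  · simp only [h0, Nat.cast_zero, Real.logb_zero]; positivity
  · calc Real.logb 2 (dyadicCount A n) ≤ Real.logb 2 (C * 2 ^ x) :=
          Real.logb_le_logb_of_le one_lt_two (by exact_mod_cast h0) h
      _ = _ := by
          rw [Real.logb_mul (by positivity) (by positivity), Real.logb_rpow two_pos (by norm_num)]

lemma logb_dyadicCount_div_le_one (A : Set ℕ+) (n : ℕ) :
    Real.logb 2 (dyadicCount A n) / n ≤ 1 := by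
  refine div_le_one_of_le₀ ?_ n.cast_nonneg
  have h := logb_dyadicCount_le (A := A) (n := n) (C := 1) (x := n) le_rfl n.cast_nonneg
    (by rw [one_mul, Real.rpow_natCast]; exact_mod_cast dyadicCount_le A n)
  simpa using h

lemma dyadicCount_mul_le_tsum (A : Set ℕ+) {s : ℝ} (hs : 0 ≤ s) (n : ℕ) :
    (dyadicCount A n : ENNReal) * ((2 : ENNReal) ^ n) ^ (-s) ≤
      ∑' m : A, (((m : ℕ+) : ℕ) : ENNReal) ^ (-s) := by
  have hF := finite_dyadic A n
  rw [tsum_subtype A fun m : ℕ+ => ((m : ℕ) : ENNReal) ^ (-s)]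
  refine le_trans ?_ (ENNReal.sum_le_tsum hF.toFinset)
  rw [dyadicCount, Set.ncard_eq_toFinset_card _ hF, ← nsmul_eq_mul]
  refine Finset.card_nsmul_le_sum _ _ _ fun m hm => ?_
  obtain ⟨hmA, hm⟩ := hF.mem_toFinset.1 hm
  rw [Set.indicator_of_mem hmA]
  exact ennreal_rpow_neg_anti hs (by exact_mod_cast hm)

lemma tsum_le_tsum_dyadicCount (A : Set ℕ+) {s : ℝ} (hs : 0 ≤ s) :
    ∑' m : A, (((m : ℕ+) : ℕ) : ENNReal) ^ (-s) ≤
      ∑' n : ℕ, (dyadicCount A (n + 1) : ENNReal) * ((2 : ENNReal) ^ n) ^ (-s) := by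
  classical
  let B (n : ℕ) : Set ℕ+ := {m : ℕ+ | m ∈ A ∧ (m : ℕ) ≤ 2 ^ (n + 1)}
  have hB (n : ℕ) : (dyadicCount A (n + 1) : ENNReal) * ((2 : ENNReal) ^ n) ^ (-s) =
      ∑' m : ℕ+, (B n).indicator (fun _ => ((2 : ENNReal) ^ n) ^ (-s)) m := by
    rw [← tsum_subtype, ENNReal.tsum_set_const, dyadicCount,
      ← (finite_dyadic A (n + 1)).cast_ncard_eq]
    rfl
  rw [tsum_subtype A fun m : ℕ+ => ((m : ℕ) : ENNReal) ^ (-s)]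
  simp_rw [hB]
  rw [ENNReal.tsum_comm]
  refine ENNReal.tsum_le_tsum fun m => ?_
  by_cases hm : m ∈ A
  · refine le_trans ?_ (ENNReal.le_tsum (Nat.log 2 m))
    have hmB : m ∈ B (Nat.log 2 m) := ⟨hm, (Nat.lt_pow_succ_log_self one_lt_two _).le⟩
    rw [Set.indicator_of_mem hm, Set.indicator_of_mem hmB]
    exact ennreal_rpow_neg_anti hs
      (by exact_mod_cast Nat.pow_log_le_self 2 m.ne_zero)
  · simp [Set.indicator_of_notMem hm]

lemma two_pow_rpow_neg (n : ℕ) (s : ℝ) :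
    ((2 : ENNReal) ^ n) ^ (-s) = ENNReal.ofReal (2 ^ (-(n * s))) := by
  rw [← ENNReal.rpow_natCast, ← ENNReal.rpow_mul, ← ENNReal.ofReal_rpow_of_pos two_pos]
  simp

lemma limsup_le_of_tsum_lt_top {A : Set ℕ+} {s : ℝ} (hs : 0 ≤ s)
    (h : ∑' m : A, (((m : ℕ+) : ℕ) : ENNReal) ^ (-s) < ⊤) :
    atTop.limsup (fun n : ℕ => Real.logb 2 (dyadicCount A n) / n) ≤ s := by
  set S := ∑' m : A, (((m : ℕ+) : ℕ) : ENNReal) ^ (-s)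
  set C := max 1 S.toReal
  have hbound (n : ℕ) : (dyadicCount A n : ℝ) ≤ C * 2 ^ (n * s) := by
    have h1 := ENNReal.toReal_mono h.ne (dyadicCount_mul_le_tsum A hs n)
    rw [two_pow_rpow_neg, ENNReal.toReal_mul, ENNReal.toReal_natCast,
      ENNReal.toReal_ofReal (by positivity), Real.rpow_neg two_pos.le,
      ← div_eq_mul_inv, div_le_iff₀ (by positivity)] at h1
    exact h1.trans (mul_le_mul_of_nonneg_right (le_max_right _ _) (by positivity))
  have hlim : Tendsto (fun n : ℕ => Real.logb 2 C / n + s) atTop (𝓝 s) := by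
    simpa using (tendsto_const_div_atTop_nhds_zero_nat (Real.logb 2 C)).add_const s
  rw [← hlim.limsup_eq]
  refine limsup_le_limsup ?_
    (isBoundedUnder_of ⟨0, logb_dyadicCount_div_nonneg A⟩).isCoboundedUnder_le
    hlim.isBoundedUnder_le
  filter_upwards [eventually_gt_atTop 0] with n hn
  have hn' : (0 : ℝ) < n := by exact_mod_cast hn
  rw [div_add' _ _ _ hn'.ne', mul_comm s]
  gcongr
  exact logb_dyadicCount_le (le_max_left _ _) (by positivity) (hbound n)

lemma tsum_lt_top_of_limsup_lt {A : Set ℕ+} {s : ℝ} (hs : 0 ≤ s)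
    (h : atTop.limsup (fun n : ℕ => Real.logb 2 (dyadicCount A n) / n) < s) :
    ∑' m : A, (((m : ℕ+) : ℕ) : ENNReal) ^ (-s) < ⊤ := by
  obtain ⟨t, hLt, hts⟩ := exists_between h
  refine (tsum_le_tsum_dyadicCount A hs).trans_lt ?_
  have hterm (n : ℕ) : (dyadicCount A (n + 1) : ENNReal) * ((2 : ENNReal) ^ n) ^ (-s) =
      ENNReal.ofReal (dyadicCount A (n + 1) * 2 ^ (-(n * s))) := by
    rw [two_pow_rpow_neg, ENNReal.ofReal_mul (Nat.cast_nonneg _), ENNReal.ofReal_natCast]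
  simp_rw [hterm]
  refine Summable.tsum_ofReal_lt_top ?_
  have hr : (2 : ℝ) ^ (t - s) < 1 :=
    Real.rpow_lt_one_of_one_lt_of_neg one_lt_two (sub_neg.2 hts)
  refine Summable.of_norm_bounded_eventually_nat
    ((summable_geometric_of_lt_one (by positivity) hr).mul_left (2 ^ t)) ?_
  have hev := eventually_lt_of_limsup_lt hLt
    (isBoundedUnder_of ⟨1, logb_dyadicCount_div_le_one A⟩)
  filter_upwards [(tendsto_add_atTop_nat 1).eventually hev] with n hn
  have hcount : (dyadicCount A (n + 1) : ℝ) ≤ 2 ^ (t * (n + 1)) := by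
    rcases Nat.eq_zero_or_pos (dyadicCount A (n + 1)) with h0 | h0
    · rw [h0, Nat.cast_zero]; positivity
    · rw [div_lt_iff₀ (by positivity),
        Real.logb_lt_iff_lt_rpow one_lt_two (by exact_mod_cast h0)] at hn
      exact_mod_cast hn.le
  rw [Real.norm_of_nonneg (by positivity)]
  calc (dyadicCount A (n + 1) : ℝ) * 2 ^ (-(n * s))
      ≤ 2 ^ (t * (n + 1)) * 2 ^ (-(n * s)) := by gcongr
    _ = 2 ^ t * (2 ^ (t - s)) ^ n := by
      rw [← Real.rpow_natCast, ← Real.rpow_mul two_pos.le, ← Real.rpow_add two_pos,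
        ← Real.rpow_add two_pos]
      ring_nf

theorem zetaDim_eq_limsup_pow (A : Set ℕ+) :
    zetaDim A =
      atTop.limsup (fun n : ℕ =>
        Real.logb 2 ((Set.ncard {m : ℕ+ | m ∈ A ∧ (m : ℕ) ≤ 2 ^ n} : ℕ)) / n) := by
  change zetaDim A = atTop.limsup fun n : ℕ => Real.logb 2 (dyadicCount A n) / n
  have hL : 0 ≤ atTop.limsup fun n : ℕ => Real.logb 2 (dyadicCount A n) / n :=
    le_limsup_of_frequently_le (Frequently.of_forall (logb_dyadicCount_div_nonneg A))
      (isBoundedUnder_of ⟨1, logb_dyadicCount_div_le_one A⟩)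
  have hmem {s : ℝ} (hs : atTop.limsup (fun n : ℕ => Real.logb 2 (dyadicCount A n) / n) < s) :
      s ∈ {s : ℝ | 0 ≤ s ∧ (∑' n : A, (((n : ℕ+) : ℕ) : ENNReal) ^ (-s)) < ⊤} :=
    ⟨hL.trans hs.le, tsum_lt_top_of_limsup_lt (hL.trans hs.le) hs⟩
  refine le_antisymm (le_of_forall_gt_imp_ge_of_dense fun s hs => ?_) ?_
  · exact csInf_le ⟨0, fun _ h => h.1⟩ (hmem hs)
  · exact le_csInf ⟨_, hmem (lt_add_one _)⟩ fun s hs => limsup_le_of_tsum_lt_top hs.1 hs.2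
end

section
/- Zeta-dimension in ℤ^d is invariant under bi-Lipschitz maps: if f : ℤ^d → ℤ^d is bi-Lipschitz, then for every A ⊆ ℤ^d, Dim_ζ(f(A)) = Dim_ζ(A). -/
open Filter

/-- Euclidean norm of a point of `ℤ^d`. -/
noncomputable def znorm {d : ℕ} (v : Fin d → ℤ) : ℝ :=
  Real.sqrt (∑ i, ((v i : ℝ)) ^ 2)

/-- The zeta-dimension of a set `A ⊆ ℤ^d`:
`Dim_ζ(A) = inf { s ∈ [0,∞) : Σ_{0 ≠ n⃗ ∈ A} ‖n⃗‖^{-s} < ∞ }`. -/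
noncomputable def zetaDimZ {d : ℕ} (A : Set (Fin d → ℤ)) : ℝ :=
  sInf {s : ℝ | 0 ≤ s ∧
    (∑' v : ↥(A \ {0}), ENNReal.ofReal (znorm (v : Fin d → ℤ)) ^ (-s)) < ⊤}

/-- `f : ℤ^d → ℤ^d` is bi-Lipschitz if there are `α, β ∈ (0,∞)` with
`α‖m⃗ − n⃗‖ ≤ ‖f(m⃗) − f(n⃗)‖ ≤ β‖m⃗ − n⃗‖` for all `m⃗, n⃗ ∈ ℤ^d`. -/
def BiLipschitzZ {d : ℕ} (f : (Fin d → ℤ) → (Fin d → ℤ)) : Prop :=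
  ∃ α β : ℝ, 0 < α ∧ 0 < β ∧ ∀ m n : Fin d → ℤ,
    α * znorm (m - n) ≤ znorm (f m - f n) ∧ znorm (f m - f n) ≤ β * znorm (m - n)

theorem znorm_eq_norm {d : ℕ} (v : Fin d → ℤ) :
    znorm v = ‖(WithLp.toLp 2 (fun i => (v i : ℝ)) : EuclideanSpace ℝ (Fin d))‖ := by
  simp [znorm, EuclideanSpace.norm_eq]

theorem znorm_add_le {d : ℕ} (v w : Fin d → ℤ) : znorm (v + w) ≤ znorm v + znorm w := by
  simp only [znorm_eq_norm]
  have key := norm_add_le (WithLp.toLp 2 (fun i => (v i : ℝ)) : EuclideanSpace ℝ (Fin d))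
    (WithLp.toLp 2 fun i => (w i : ℝ))
  rw [← WithLp.toLp_add] at key
  simpa [Pi.add_def] using key

theorem znorm_sub_le {d : ℕ} (v w : Fin d → ℤ) : znorm (v - w) ≤ znorm v + znorm w := by
  simp only [znorm_eq_norm]
  have key := norm_sub_le (WithLp.toLp 2 (fun i => (v i : ℝ)) : EuclideanSpace ℝ (Fin d))
    (WithLp.toLp 2 fun i => (w i : ℝ))
  rw [← WithLp.toLp_sub] at key
  simpa [Pi.sub_def] using key

theorem znorm_nonneg {d : ℕ} (v : Fin d → ℤ) : 0 ≤ znorm v := Real.sqrt_nonneg _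

theorem one_le_znorm {d : ℕ} {v : Fin d → ℤ} (hv : v ≠ 0) : 1 ≤ znorm v := by
  obtain ⟨i, hi⟩ := Function.ne_iff.mp hv
  have h1 : (1 : ℝ) ≤ (v i : ℝ) ^ 2 := by
    have hi' : v i ≠ 0 := hi
    exact_mod_cast Int.add_one_le_iff.mpr (by positivity : 0 < v i ^ 2)
  refine Real.one_le_sqrt.mpr (h1.trans ?_)
  exact Finset.single_le_sum (f := fun j => (v j : ℝ) ^ 2) (fun j _ => sq_nonneg _)
    (Finset.mem_univ i)

/-- An injection that enlarges norms by at most a constant factor reflects finiteness of the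
zeta sums. -/
theorem zetaSum_lt_top_of_injOn {d : ℕ} {h : (Fin d → ℤ) → (Fin d → ℤ)}
    {A B : Set (Fin d → ℤ)} (hinj : Set.InjOn h A) (hmaps : Set.MapsTo h A B) {C : ℝ}
    (hC : 0 < C) (hbound : ∀ v ∈ A, v ≠ 0 → znorm (h v) ≤ C * znorm v) {s : ℝ} (hs : 0 ≤ s)
    (hB : (∑' w : ↥(B \ {0}), ENNReal.ofReal (znorm (w : Fin d → ℤ)) ^ (-s)) < ⊤) :
    (∑' v : ↥(A \ {0}), ENNReal.ofReal (znorm (v : Fin d → ℤ)) ^ (-s)) < ⊤ := by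
  set F : (Fin d → ℤ) → ENNReal := fun v => ENNReal.ofReal (znorm v) ^ (-s) with hF
  set K : ENNReal := ENNReal.ofReal C ^ s with hK
  have hKtop : K ≠ ⊤ := ENNReal.rpow_ne_top_of_nonneg hs ENNReal.ofReal_ne_top
  have hpt : ∀ v ∈ A, v ≠ 0 → F v ≤ K * F (h v) := by
    intro v hv hv0
    have hle : ENNReal.ofReal (znorm (h v)) ^ s ≤ K * ENNReal.ofReal (znorm v) ^ s := by
      rw [hK, ← ENNReal.mul_rpow_of_nonneg _ _ hs, ← ENNReal.ofReal_mul hC.le]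
      exact ENNReal.rpow_le_rpow (ENNReal.ofReal_le_ofReal (hbound v hv hv0)) hs
    have hKpos : K ≠ 0 := by simp [hK, ENNReal.rpow_eq_zero_iff, hC]
    have hinv := ENNReal.inv_le_inv.mpr hle
    rw [ENNReal.mul_inv (Or.inl hKpos) (Or.inl hKtop)] at hinv
    simp only [hF, ENNReal.rpow_neg]
    calc (ENNReal.ofReal (znorm v) ^ s)⁻¹
        = K * (K⁻¹ * (ENNReal.ofReal (znorm v) ^ s)⁻¹) := by
          rw [← mul_assoc, ENNReal.mul_inv_cancel hKpos hKtop, one_mul]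
      _ ≤ _ := by gcongr
  have hsub : A \ {0} ⊆ (A ∩ h ⁻¹' {0}) \ {0} ∪ (A \ h ⁻¹' {0}) \ {0} := by
    intro v hv
    by_cases hv0 : h v = 0 <;> simp_all
  have hfin : ((A ∩ h ⁻¹' {0}) \ {0}).Finite := by
    refine Set.Subsingleton.finite fun v hv w hw => hinj hv.1.1 hw.1.1 ?_
    exact hv.1.2.trans hw.1.2.symm
  have hfirst : (∑' v : ↥((A ∩ h ⁻¹' {0}) \ {0}), F v) < ⊤ := by
    have := hfin.fintype
    rw [tsum_fintype]
    refine ENNReal.sum_lt_top.mpr fun v _ => lt_of_le_of_lt ?_ ENNReal.one_lt_top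
    simp only [hF, ENNReal.rpow_neg, ENNReal.inv_le_one]
    simpa using ENNReal.rpow_le_rpow (ENNReal.one_le_ofReal.mpr (one_le_znorm v.2.2)) hs
  have hsecond : (∑' v : ↥((A \ h ⁻¹' {0}) \ {0}), F v) < ⊤ := by
    let φ : ↥((A \ h ⁻¹' {0}) \ {0}) → ↥(B \ {0}) :=
      fun v => ⟨h v, hmaps v.2.1.1, v.2.1.2⟩
    have hφ : Function.Injective φ := fun v w hvw =>
      Subtype.ext (hinj v.2.1.1 w.2.1.1 (congrArg Subtype.val hvw))
    calc (∑' v : ↥((A \ h ⁻¹' {0}) \ {0}), F v)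
        ≤ ∑' v : ↥((A \ h ⁻¹' {0}) \ {0}), K * F (φ v) :=
          ENNReal.tsum_le_tsum fun v => hpt v v.2.1.1 v.2.2
      _ = K * ∑' v : ↥((A \ h ⁻¹' {0}) \ {0}), F (φ v) := ENNReal.tsum_mul_left
      _ ≤ K * ∑' w : ↥(B \ {0}), F w := by
          gcongr
          exact ENNReal.tsum_comp_le_tsum_of_injective hφ fun w => F w
      _ < ⊤ := ENNReal.mul_lt_top hKtop.lt_top hB
  calc (∑' v : ↥(A \ {0}), F v)
      ≤ ∑' v : ↥((A ∩ h ⁻¹' {0}) \ {0} ∪ (A \ h ⁻¹' {0}) \ {0}), F v :=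
        ENNReal.tsum_mono_subtype F hsub
    _ ≤ _ := ENNReal.tsum_union_le F _ _
    _ < ⊤ := ENNReal.add_lt_top.mpr ⟨hfirst, hsecond⟩

theorem zetaDimZ_biLipschitz_invariant {d : ℕ} (hd : 0 < d)
    (f : (Fin d → ℤ) → (Fin d → ℤ)) (hf : BiLipschitzZ f) (A : Set (Fin d → ℤ)) :
    zetaDimZ (f '' A) = zetaDimZ A := by
  obtain ⟨α, β, hα, hβ, hf⟩ := hf
  have hinj : Function.Injective f := by
    intro m n hmn
    by_contra hne
    have h1 := (hf m n).1
    have h2 := one_le_znorm (sub_ne_zero.mpr hne)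
    have h3 : znorm (f m - f n) = 0 := by simp [hmn, znorm]
    nlinarith
  have h0 := znorm_nonneg (f 0)
  unfold zetaDimZ
  congr 1
  ext s
  refine and_congr_right fun hs => ⟨?_, ?_⟩
  · refine zetaSum_lt_top_of_injOn (C := β + znorm (f 0)) hinj.injOn (Set.mapsTo_image f A)
      (by linarith) (fun v _ hv => ?_) hs
    have h1 := one_le_znorm hv
    have h2 := (hf v 0).2
    have h3 := znorm_add_le (f v - f 0) (f 0)
    simp only [sub_zero, sub_add_cancel] at h2 h3
    nlinarith
  · have hleft := Function.leftInverse_invFun hinj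
    refine zetaSum_lt_top_of_injOn (h := Function.invFun f) (C := (1 + znorm (f 0)) / α) ?_ ?_
      (by positivity) ?_ hs
    · rintro _ ⟨v, _, rfl⟩ _ ⟨w, _, rfl⟩ hvw
      rw [hleft, hleft] at hvw
      rw [hvw]
    · rintro _ ⟨v, hv, rfl⟩
      rwa [hleft]
    · rintro _ ⟨v, _, rfl⟩ hv
      rw [hleft, div_mul_eq_mul_div, le_div_iff₀ hα]
      have h1 := one_le_znorm hv
      have h2 := (hf v 0).1
      have h3 := znorm_sub_le (f v) (f 0)
      rw [sub_zero] at h2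
      nlinarith
end

section
/- Entropy characterization of zeta-dimension in ℤ^d: for every A ⊆ ℤ^d, Dim_ζ(A) equals the limit superior, as n → ∞, of log|A_{[1,n]}| / log n, where A_{[1,n]} = { n⃗ ∈ A : 1 ≤ ‖n⃗‖ ≤ n } and log denotes the base-2 logarithm. -/
open Filter

theorem one_le_znorm_iff {d : ℕ} (v : Fin d → ℤ) : 1 ≤ znorm v ↔ v ≠ 0 := by
  constructor
  · rintro h rfl
    norm_num [znorm] at h
  · intro h
    obtain ⟨i, hi⟩ := Function.ne_iff.mp h
    have hi' : (1 : ℤ) ≤ v i ^ 2 := Int.add_one_le_iff.mpr (sq_pos_of_ne_zero hi)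
    rw [znorm, Real.one_le_sqrt]
    calc (1 : ℝ) ≤ (v i : ℝ) ^ 2 := by exact_mod_cast hi'
      _ ≤ ∑ j, (v j : ℝ) ^ 2 :=
        Finset.single_le_sum (f := fun j => (v j : ℝ) ^ 2) (fun _ _ => sq_nonneg _)
          (Finset.mem_univ i)

theorem abs_coord_le_znorm {d : ℕ} (v : Fin d → ℤ) (i : Fin d) : |(v i : ℝ)| ≤ znorm v :=
  Real.abs_le_sqrt (Finset.single_le_sum (f := fun j => (v j : ℝ) ^ 2)
    (fun _ _ => sq_nonneg _) (Finset.mem_univ i))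

/-- The points of `A` of norm between `1` and `n`. -/
def annulus {d : ℕ} (A : Set (Fin d → ℤ)) (n : ℕ) : Set (Fin d → ℤ) :=
  {v ∈ A | 1 ≤ znorm v ∧ znorm v ≤ (n : ℝ)}

theorem annulus_subset_Icc {d : ℕ} (A : Set (Fin d → ℤ)) (n : ℕ) :
    annulus A n ⊆ ↑(Finset.Icc (fun _ : Fin d => -(n : ℤ)) (fun _ => (n : ℤ))) := by
  rintro v ⟨-, -, hv⟩
  have h (i : Fin d) : |v i| ≤ n := by exact_mod_cast (abs_coord_le_znorm v i).trans hv
  simp only [Finset.coe_Icc, Set.mem_Icc, Pi.le_def]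
  exact ⟨fun i => (abs_le.mp (h i)).1, fun i => (abs_le.mp (h i)).2⟩

theorem annulus_finite {d : ℕ} (A : Set (Fin d → ℤ)) (n : ℕ) : (annulus A n).Finite :=
  (Finset.finite_toSet _).subset (annulus_subset_Icc A n)

theorem annulus_subset_diff {d : ℕ} (A : Set (Fin d → ℤ)) (n : ℕ) : annulus A n ⊆ A \ {0} :=
  fun v hv => ⟨hv.1, (one_le_znorm_iff v).mp hv.2.1⟩

theorem ncard_annulus_le {d : ℕ} (A : Set (Fin d → ℤ)) (n : ℕ) :
    (annulus A n).ncard ≤ (2 * n + 1) ^ d := by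
  have h := Set.ncard_le_ncard (annulus_subset_Icc A n) (Finset.finite_toSet _)
  rw [Set.ncard_coe_finset, Pi.card_Icc] at h
  simp only [Int.card_Icc, Finset.prod_const, Finset.card_univ, Fintype.card_fin] at h
  convert h using 2
  omega

/-- The logarithmic growth ratio of the counting function of `A`. -/
noncomputable def entropyRatio {d : ℕ} (A : Set (Fin d → ℤ)) (n : ℕ) : ℝ :=
  Real.logb 2 ((annulus A n).ncard : ℕ) / Real.logb 2 n

theorem logb_two_natCast_nonneg (n : ℕ) : 0 ≤ Real.logb 2 (n : ℝ) :=
  div_nonneg (Real.log_natCast_nonneg n) (Real.log_nonneg one_le_two)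

theorem logb_two_natCast_pos {n : ℕ} (hn : 2 ≤ n) : 0 < Real.logb 2 (n : ℝ) :=
  Real.logb_pos one_lt_two (by exact_mod_cast hn)

theorem entropyRatio_nonneg {d : ℕ} (A : Set (Fin d → ℤ)) (n : ℕ) : 0 ≤ entropyRatio A n :=
  div_nonneg (logb_two_natCast_nonneg _) (logb_two_natCast_nonneg _)

/-- A power bound for the counting function bounds the growth ratio. -/
theorem entropyRatio_le_of_ncard_le {d : ℕ} (A : Set (Fin d → ℤ)) {n : ℕ} (hn : 2 ≤ n)
    {C s : ℝ} (hC : 1 ≤ C) (hs : 0 ≤ s) (h : ((annulus A n).ncard : ℝ) ≤ C * (n : ℝ) ^ s) :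
    entropyRatio A n ≤ Real.logb 2 C / Real.logb 2 n + s := by
  have hlog := logb_two_natCast_pos hn
  have hn0 : (0 : ℝ) < n := by positivity
  rw [entropyRatio, div_add' _ _ _ hlog.ne', div_le_div_iff_of_pos_right hlog]
  rcases Nat.eq_zero_or_pos (annulus A n).ncard with h0 | h0
  · rw [h0, Nat.cast_zero, Real.logb_zero]
    exact add_nonneg (Real.logb_nonneg one_lt_two hC) (mul_nonneg hs hlog.le)
  · refine (Real.logb_le_logb_of_le one_lt_two (by exact_mod_cast h0) h).trans_eq ?_
    rw [Real.logb_mul (by positivity) (by positivity), Real.logb_rpow_eq_mul_logb_of_pos hn0]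

theorem entropyRatio_le {d : ℕ} (A : Set (Fin d → ℤ)) {n : ℕ} (hn : 2 ≤ n) :
    entropyRatio A n ≤ 3 * d := by
  have h : (annulus A n).ncard ≤ n ^ (3 * d) := by
    refine (ncard_annulus_le A n).trans ?_
    rw [pow_mul]
    exact Nat.pow_le_pow_left (by nlinarith [Nat.mul_le_mul hn hn]) d
  have h' : ((annulus A n).ncard : ℝ) ≤ 1 * (n : ℝ) ^ (3 * d : ℝ) := by
    rw [one_mul]
    have : (3 * d : ℝ) = ((3 * d : ℕ) : ℝ) := by push_cast; rfl
    rw [this, Real.rpow_natCast]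
    exact_mod_cast h
  simpa using entropyRatio_le_of_ncard_le A hn le_rfl (by positivity) h'

theorem isBoundedUnder_entropyRatio {d : ℕ} (A : Set (Fin d → ℤ)) :
    IsBoundedUnder (· ≤ ·) atTop (entropyRatio A) :=
  isBoundedUnder_of_eventually_le
    ((eventually_ge_atTop 2).mono fun _ hn => entropyRatio_le A hn)

theorem isCoboundedUnder_entropyRatio {d : ℕ} (A : Set (Fin d → ℤ)) :
    IsCoboundedUnder (· ≤ ·) atTop (entropyRatio A) :=
  (isBoundedUnder_of_eventually_ge
    (Eventually.of_forall (entropyRatio_nonneg A))).isCoboundedUnder_le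

theorem limsup_entropyRatio_nonneg {d : ℕ} (A : Set (Fin d → ℤ)) :
    0 ≤ atTop.limsup (entropyRatio A) :=
  le_limsup_of_frequently_le (Eventually.of_forall (entropyRatio_nonneg A)).frequently
    (isBoundedUnder_entropyRatio A)

theorem ncard_annulus_mul_le_tsum {d : ℕ} (A : Set (Fin d → ℤ)) (n : ℕ)
    {s : ℝ} (hs : 0 ≤ s) :
    ((annulus A n).ncard : ENNReal) * ENNReal.ofReal ((n : ℝ) ^ (-s)) ≤
      ∑' v : ↥(A \ {0}), ENNReal.ofReal (znorm (v : Fin d → ℤ)) ^ (-s) := by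
  have hcard : (((annulus A n).encard : ℕ∞) : ENNReal) = ((annulus A n).ncard : ENNReal) := by
    rw [← (annulus_finite A n).cast_ncard_eq]; rfl
  calc ((annulus A n).ncard : ENNReal) * ENNReal.ofReal ((n : ℝ) ^ (-s))
      = ∑' _ : annulus A n, ENNReal.ofReal ((n : ℝ) ^ (-s)) := by
        rw [ENNReal.tsum_set_const, hcard]
    _ ≤ ∑' v : annulus A n, ENNReal.ofReal (znorm (v : Fin d → ℤ)) ^ (-s) := by
        refine ENNReal.tsum_le_tsum fun v => ?_
        have hv : 0 < znorm (v : Fin d → ℤ) := one_pos.trans_le v.2.2.1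
        rw [ENNReal.ofReal_rpow_of_pos hv]
        exact ENNReal.ofReal_le_ofReal
          (Real.rpow_le_rpow_of_nonpos hv v.2.2.2 (neg_nonpos.mpr hs))
    _ ≤ _ := ENNReal.tsum_mono_subtype
        (fun v : Fin d → ℤ => ENNReal.ofReal (znorm v) ^ (-s)) (annulus_subset_diff A n)

theorem limsup_entropyRatio_le {d : ℕ} (A : Set (Fin d → ℤ)) {s : ℝ} (hs : 0 ≤ s)
    (h : (∑' v : ↥(A \ {0}), ENNReal.ofReal (znorm (v : Fin d → ℤ)) ^ (-s)) < ⊤) :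
    atTop.limsup (entropyRatio A) ≤ s := by
  set S := ∑' v : ↥(A \ {0}), ENNReal.ofReal (znorm (v : Fin d → ℤ)) ^ (-s)
  have hlog : Tendsto (fun n : ℕ => Real.logb 2 (max 1 S.toReal) / Real.logb 2 n + s)
      atTop (nhds s) := by
    have := ((Real.tendsto_logb_atTop one_lt_two).comp
      tendsto_natCast_atTop_atTop).const_div_atTop (Real.logb 2 (max 1 S.toReal))
    simpa using this.add_const s
  rw [← hlog.limsup_eq]
  refine limsup_le_limsup ?_ (isCoboundedUnder_entropyRatio A) hlog.isBoundedUnder_le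
  filter_upwards [eventually_ge_atTop 2] with n hn
  refine entropyRatio_le_of_ncard_le A hn (le_max_left _ _) hs ?_
  have hn0 : (0 : ℝ) < n := by positivity
  have h1 := ENNReal.toReal_mono h.ne (ncard_annulus_mul_le_tsum A n hs)
  rw [ENNReal.toReal_mul, ENNReal.toReal_natCast, ENNReal.toReal_ofReal (by positivity),
    Real.rpow_neg hn0.le, ← div_eq_mul_inv, div_le_iff₀ (by positivity)] at h1
  exact h1.trans (mul_le_mul_of_nonneg_right (le_max_right _ _) (by positivity))

/-- Dyadic domination of the zeta series by the counting function. -/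
theorem tsum_znorm_rpow_le {d : ℕ} (A : Set (Fin d → ℤ)) {s : ℝ} (hs : 0 ≤ s) :
    (∑' v : ↥(A \ {0}), ENNReal.ofReal (znorm (v : Fin d → ℤ)) ^ (-s)) ≤
      ∑' k : ℕ, ENNReal.ofReal
        (((annulus A (2 ^ k)).ncard : ℝ) * (2 ^ s * (2 ^ k : ℝ) ^ (-s))) := by
  have hcount (k : ℕ) : ENNReal.ofReal
        (((annulus A (2 ^ k)).ncard : ℝ) * (2 ^ s * (2 ^ k : ℝ) ^ (-s))) =
      ∑' v, (annulus A (2 ^ k)).indicator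
        (fun _ => ENNReal.ofReal (2 ^ s * (2 ^ k : ℝ) ^ (-s))) v := by
    rw [← tsum_subtype, ENNReal.tsum_set_const, ← (annulus_finite A _).cast_ncard_eq,
      ENNReal.ofReal_mul (Nat.cast_nonneg _), ENNReal.ofReal_natCast]
    rfl
  rw [tsum_congr hcount, ENNReal.tsum_comm,
    tsum_subtype (A \ {0}) (fun v : Fin d → ℤ => ENNReal.ofReal (znorm v) ^ (-s))]
  refine ENNReal.tsum_le_tsum fun v => ?_
  by_cases hv : v ∈ A \ {0}
  swap
  · rw [Set.indicator_of_notMem hv]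
    exact zero_le
  rw [Set.indicator_of_mem hv]
  have hv1 : 1 ≤ znorm v := (one_le_znorm_iff v).mpr hv.2
  have hv0 : 0 < znorm v := one_pos.trans_le hv1
  obtain ⟨k, hk, hk'⟩ := exists_nat_pow_near hv1 one_lt_two
  refine le_trans ?_ (ENNReal.le_tsum (k + 1))
  have hmem : v ∈ annulus A (2 ^ (k + 1)) := ⟨hv.1, hv1, by push_cast; exact hk'.le⟩
  rw [Set.indicator_of_mem hmem, ENNReal.ofReal_rpow_of_pos hv0]
  refine ENNReal.ofReal_le_ofReal ?_
  have h2 : (2 : ℝ) ^ s * (2 ^ (k + 1) : ℝ) ^ (-s) = (2 ^ k : ℝ) ^ (-s) := by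
    rw [pow_succ, Real.mul_rpow (by positivity) (by positivity), mul_left_comm,
      ← Real.rpow_add two_pos, add_neg_cancel, Real.rpow_zero, mul_one]
  rw [h2]
  exact Real.rpow_le_rpow_of_nonpos (by positivity) hk (neg_nonpos.mpr hs)

theorem ncard_annulus_le_rpow {d : ℕ} (A : Set (Fin d → ℤ)) {n : ℕ} (hn : 2 ≤ n) {t : ℝ}
    (h : entropyRatio A n ≤ t) : ((annulus A n).ncard : ℝ) ≤ (n : ℝ) ^ t := by
  have hn0 : (0 : ℝ) < n := by positivity
  rcases Nat.eq_zero_or_pos (annulus A n).ncard with h0 | h0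
  · rw [h0, Nat.cast_zero]
    positivity
  · rw [entropyRatio, div_le_iff₀ (logb_two_natCast_pos hn)] at h
    rwa [← Real.logb_le_logb one_lt_two (by exact_mod_cast h0) (by positivity),
      Real.logb_rpow_eq_mul_logb_of_pos hn0]

theorem tsum_znorm_rpow_lt_top {d : ℕ} (A : Set (Fin d → ℤ)) {s : ℝ}
    (h : atTop.limsup (entropyRatio A) < s) :
    (∑' v : ↥(A \ {0}), ENNReal.ofReal (znorm (v : Fin d → ℤ)) ^ (-s)) < ⊤ := by
  obtain ⟨t, ht, hts⟩ := exists_between h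
  have hs : 0 ≤ s := (limsup_entropyRatio_nonneg A).trans h.le
  refine (tsum_znorm_rpow_le A hs).trans_lt ?_
  refine Summable.tsum_ofReal_lt_top ?_
  have hr : (2 : ℝ) ^ (t - s) < 1 := Real.rpow_lt_one_of_one_lt_of_neg one_lt_two (by linarith)
  have hgeom : Summable fun k : ℕ => (2 : ℝ) ^ s * ((2 : ℝ) ^ (t - s)) ^ k :=
    (summable_geometric_of_lt_one (by positivity) hr).mul_left _
  refine Summable.of_norm_bounded_eventually_nat hgeom ?_
  have hev := (tendsto_pow_atTop_atTop_of_one_lt (one_lt_two (α := ℕ))).eventually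
    ((eventually_lt_of_limsup_lt ht (isBoundedUnder_entropyRatio A)).and
      (eventually_ge_atTop 2))
  filter_upwards [hev] with k hk
  have hN := ncard_annulus_le_rpow A hk.2 hk.1.le
  push_cast at hN
  rw [Real.norm_of_nonneg (by positivity)]
  calc ((annulus A (2 ^ k)).ncard : ℝ) * (2 ^ s * (2 ^ k : ℝ) ^ (-s))
      ≤ (2 ^ k : ℝ) ^ t * (2 ^ s * (2 ^ k : ℝ) ^ (-s)) := by gcongr
    _ = 2 ^ s * (2 ^ k : ℝ) ^ (t - s) := by
        rw [mul_left_comm, ← Real.rpow_add (by positivity), sub_eq_add_neg]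
    _ = 2 ^ s * ((2 : ℝ) ^ (t - s)) ^ k := by
        rw [Real.rpow_pow_comm zero_le_two]

theorem zetaDimZ_eq_limsup {d : ℕ} (hd : 0 < d) (A : Set (Fin d → ℤ)) :
    zetaDimZ A =
      atTop.limsup (fun n : ℕ =>
        Real.logb 2 ((Set.ncard {v ∈ A | 1 ≤ znorm v ∧ znorm v ≤ (n : ℝ)} : ℕ)) /
          Real.logb 2 n) := by
  change zetaDimZ A = atTop.limsup (entropyRatio A)
  have hmem {s : ℝ} (hs : atTop.limsup (entropyRatio A) < s) : s ∈ {s : ℝ | 0 ≤ s ∧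
      (∑' v : ↥(A \ {0}), ENNReal.ofReal (znorm (v : Fin d → ℤ)) ^ (-s)) < ⊤} :=
    ⟨(limsup_entropyRatio_nonneg A).trans hs.le, tsum_znorm_rpow_lt_top A hs⟩
  refine le_antisymm ?_ ?_
  · exact le_of_forall_gt_imp_ge_of_dense fun s hs => csInf_le ⟨0, fun _ hx => hx.1⟩ (hmem hs)
  · exact le_csInf ⟨_, hmem (lt_add_one _)⟩ fun s hs => limsup_entropyRatio_le A hs.1 hs.2
end

section
/- Let Σ = {0, 1, …, k−1} with k ≥ 2, let Δ be a nonempty subset of Σ − {0}, and let B ⊆ Σ* be a finite instantaneous code. Let A = { n ∈ ℤ⁺ : rep_k(n) ∈ ΔB* }, where ΔB* is the set of strings consisting of a symbol of Δ followed by a concatenation of finitely many (possibly zero) strings of B. Then Dim_ζ(A) = s*, where s* is the unique solution of the equation Σ_{w∈B} k^{−s*·|w|} = 1. -/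
open scoped ENNReal

/-- Concatenation is injective on the sequences of words of a prefix code. -/
theorem flatten_injOn_of_prefixFree {α : Type*} {B : Set (List α)} (hnil : [] ∉ B)
    (hprefix : ∀ u ∈ B, ∀ v ∈ B, u <+: v → u = v) :
    Set.InjOn List.flatten {l : List (List α) | ∀ w ∈ l, w ∈ B} := by
  intro l hl
  induction l with
  | nil =>
    rintro (_ | ⟨v, m⟩) hm h
    · rfl
    · have hv : v = [] := by simp_all
      exact absurd (hm v (by simp)) (hv ▸ hnil)
  | cons u l ih =>
    rintro (_ | ⟨v, m⟩) hm h
    · have hu : u = [] := by simp_all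
      exact absurd (hl u (by simp)) (hu ▸ hnil)
    · have hu := hl u (by simp)
      have hv := hm v (by simp)
      simp only [List.flatten_cons] at h
      have huv : u = v := by
        rcases List.prefix_or_prefix_of_prefix (List.prefix_append u l.flatten)
          (h ▸ List.prefix_append v m.flatten) with h' | h'
        · exact hprefix u hu v hv h'
        · exact (hprefix v hv u hu h').symm
      subst huv
      rw [ih (fun w hw => hl w (by simp [hw])) (fun w hw => hm w (by simp [hw]))
        (List.append_cancel_left h)]

/-- The sum of a multiplicative weight over all finite sequences is a geometric series. -/
theorem ENNReal.tsum_list_prod {α : Type*} [Fintype α] (g : α → ℝ≥0∞) :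
    ∑' l : List α, (l.map g).prod = ∑' n : ℕ, (∑ a, g a) ^ n := by
  rw [← List.equivSigmaTuple.symm.tsum_eq, ENNReal.tsum_sigma']
  refine tsum_congr fun n => ?_
  rw [tsum_fintype, Fintype.sum_pow]
  refine Finset.sum_congr rfl fun p _ => ?_
  simp [List.equivSigmaTuple, List.map_ofFn, List.prod_ofFn]

theorem ENNReal.tsum_pow_length_flatten {α : Type*} (B : Finset (List α)) (x : ℝ≥0∞) :
    ∑' l : List B, x ^ (l.map Subtype.val).flatten.length
      = ∑' n : ℕ, (∑ w ∈ B, x ^ w.length) ^ n := by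
  rw [← Finset.sum_coe_sort, ← ENNReal.tsum_list_prod]
  refine tsum_congr fun l => ?_
  induction l with
  | nil => simp
  | cons w l ih =>
    simp only [List.map_cons, List.flatten_cons, List.length_append, pow_add, ih, List.prod_cons]

theorem ENNReal.tsum_pow_lt_top_iff (r : ℝ≥0∞) : ∑' n : ℕ, r ^ n < ⊤ ↔ r < 1 := by
  rw [ENNReal.tsum_geometric, ENNReal.inv_lt_top, tsub_pos_iff_lt]

theorem rpow_neg_le_of_pow_le {k n L : ℕ} {s : ℝ} (hs : 0 ≤ s) (h : k ^ L ≤ n) :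
    (n : ℝ≥0∞) ^ (-s) ≤ ((k : ℝ≥0∞) ^ (-s)) ^ L := by
  rw [← ENNReal.rpow_natCast, ← ENNReal.rpow_mul, mul_comm, ENNReal.rpow_mul,
    ENNReal.rpow_natCast, ENNReal.rpow_neg, ENNReal.rpow_neg]
  gcongr
  exact_mod_cast h

theorem le_rpow_neg_of_le_pow {k n L : ℕ} {s : ℝ} (hs : 0 ≤ s) (h : n ≤ k ^ L) :
    ((k : ℝ≥0∞) ^ (-s)) ^ L ≤ (n : ℝ≥0∞) ^ (-s) := by
  rw [← ENNReal.rpow_natCast, ← ENNReal.rpow_mul, mul_comm, ENNReal.rpow_mul,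
    ENNReal.rpow_natCast, ENNReal.rpow_neg, ENNReal.rpow_neg]
  gcongr
  exact_mod_cast h

theorem sum_rpow_neg_pow_length (k : ℕ) (hk : 0 < k) {α : Type*} (B : Finset (List α)) (s : ℝ) :
    ∑ w ∈ B, ((k : ℝ≥0∞) ^ (-s)) ^ w.length
      = ENNReal.ofReal (∑ w ∈ B, (k : ℝ) ^ (-(s * (w.length : ℝ)))) := by
  have hk' : (0 : ℝ) < k := by exact_mod_cast hk
  rw [ENNReal.ofReal_sum_of_nonneg fun w _ => by positivity]
  refine Finset.sum_congr rfl fun w _ => ?_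
  rw [← ENNReal.ofReal_rpow_of_pos hk', ENNReal.ofReal_natCast, ← neg_mul, ENNReal.rpow_mul,
    ENNReal.rpow_natCast]

/-- The exponential sum of a nonempty code strictly decreases in the exponent. -/
theorem strictAnti_sum_rpow_neg_length (k : ℕ) (hk : 2 ≤ k) {α : Type*} (B : Finset (List α))
    (hne : B.Nonempty) (hnil : [] ∉ B) :
    StrictAnti fun s : ℝ => ∑ w ∈ B, (k : ℝ) ^ (-(s * (w.length : ℝ))) := by
  intro s t hst
  refine Finset.sum_lt_sum_of_nonempty hne fun w hw => ?_
  have hw0 : (0 : ℝ) < w.length := by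
    exact_mod_cast List.length_pos_iff.2 fun h => hnil (h ▸ hw)
  have hk1 : (1 : ℝ) < k := by exact_mod_cast hk
  exact Real.rpow_lt_rpow_of_exponent_lt hk1 (by nlinarith)

theorem digits_ofDigits_reverse_cons {k a : ℕ} (hk : 1 < k) (ha0 : a ≠ 0) (hak : a < k)
    {l : List ℕ} (hl : ∀ c ∈ l, c < k) :
    Nat.digits k (Nat.ofDigits k (a :: l).reverse) = (a :: l).reverse := by
  refine Nat.digits_ofDigits k hk _ (fun c hc => ?_) (fun _ => by simpa using ha0)
  rcases List.mem_cons.1 (List.mem_reverse.1 hc) with rfl | h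
  exacts [hak, hl c h]

theorem pow_length_le_and_le_of_reverse_digits_eq {k n a : ℕ} (hk : 1 < k) {l : List ℕ}
    (h : (Nat.digits k n).reverse = a :: l) : k ^ l.length ≤ n ∧ n ≤ k ^ (l.length + 1) := by
  have hlen : (Nat.digits k n).length = l.length + 1 := by
    rw [← List.length_reverse, h, List.length_cons]
  constructor
  · exact (Nat.lt_digits_length_iff hk n).1 (by omega)
  · exact (hlen ▸ Nat.lt_base_pow_length_digits hk).le

theorem tsum_rpow_neg_lt_top {k : ℕ} (hk : 2 ≤ k) (Δ : Finset ℕ) (B : Finset (List ℕ))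
    {A : Set ℕ+}
    (hA : A ⊆ {n : ℕ+ | ∃ a ∈ Δ, ∃ ws : List (List ℕ),
      (∀ w ∈ ws, w ∈ B) ∧ (Nat.digits k (n : ℕ)).reverse = a :: ws.flatten})
    {s : ℝ} (hs0 : 0 ≤ s) (hs : ∑ w ∈ B, ((k : ℝ≥0∞) ^ (-s)) ^ w.length < 1) :
    ∑' n : A, (((n : ℕ+) : ℕ) : ℝ≥0∞) ^ (-s) < ⊤ := by
  have hcode : ∀ n : A, ∃ p : Δ × List B, (Nat.digits k ((n : ℕ+) : ℕ)).reverse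
      = (p.1 : ℕ) :: (p.2.map Subtype.val).flatten := by
    rintro ⟨n, hn⟩
    obtain ⟨a, ha, ws, hws, h⟩ := hA hn
    lift ws to List B using hws
    exact ⟨(⟨a, ha⟩, ws), h⟩
  choose p hp using hcode
  have hinj : Function.Injective p := fun m n hmn => by
    have h := (hp m).trans (hmn ▸ (hp n).symm)
    exact Subtype.ext (PNat.coe_injective (Nat.digits.injective k (List.reverse_injective h)))
  calc ∑' n : A, (((n : ℕ+) : ℕ) : ℝ≥0∞) ^ (-s)
      ≤ ∑' n : A, ((k : ℝ≥0∞) ^ (-s)) ^ ((p n).2.map Subtype.val).flatten.length :=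
        ENNReal.tsum_le_tsum fun n => rpow_neg_le_of_pow_le hs0
          (pow_length_le_and_le_of_reverse_digits_eq hk (hp n)).1
    _ ≤ ∑' q : Δ × List B, ((k : ℝ≥0∞) ^ (-s)) ^ (q.2.map Subtype.val).flatten.length :=
        ENNReal.tsum_comp_le_tsum_of_injective hinj _
    _ = Δ.card * ∑' n : ℕ, (∑ w ∈ B, ((k : ℝ≥0∞) ^ (-s)) ^ w.length) ^ n := by
        rw [ENNReal.tsum_prod', ← ENNReal.tsum_pow_length_flatten]
        simp
    _ < ⊤ := ENNReal.mul_lt_top (ENNReal.natCast_lt_top _) ((ENNReal.tsum_pow_lt_top_iff _).2 hs)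

theorem sum_pow_length_lt_one_of_tsum_lt_top {k : ℕ} (hk : 2 ≤ k) {a : ℕ} (ha0 : a ≠ 0)
    (hak : a < k) (B : Finset (List ℕ)) (hBsig : ∀ w ∈ B, ∀ c ∈ w, c < k) (hBnil : [] ∉ B)
    (hBprefix : ∀ u ∈ B, ∀ v ∈ B, u <+: v → u = v) {A : Set ℕ+}
    (hA : {n : ℕ+ | ∃ ws : List (List ℕ),
      (∀ w ∈ ws, w ∈ B) ∧ (Nat.digits k (n : ℕ)).reverse = a :: ws.flatten} ⊆ A)
    {s : ℝ} (hs0 : 0 ≤ s) (hs : ∑' n : A, (((n : ℕ+) : ℕ) : ℝ≥0∞) ^ (-s) < ⊤) :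
    ∑ w ∈ B, ((k : ℝ≥0∞) ^ (-s)) ^ w.length < 1 := by
  have hcode : ∀ l : List B, ∃ n : A, (Nat.digits k ((n : ℕ+) : ℕ)).reverse
      = a :: (l.map Subtype.val).flatten := by
    intro l
    have hmem : ∀ w ∈ l.map Subtype.val, w ∈ B := by
      intro w hw
      obtain ⟨b, -, rfl⟩ := List.mem_map.1 hw
      exact b.2
    have hdig := digits_ofDigits_reverse_cons hk ha0 hak
      (l := (l.map Subtype.val).flatten) fun c hc => by
        obtain ⟨w, hw, hcw⟩ := List.mem_flatten.1 hc
        exact hBsig w (hmem w hw) c hcw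
    have hpos : 0 < Nat.ofDigits k (a :: (l.map Subtype.val).flatten).reverse := by
      refine Nat.pos_of_ne_zero fun h => ?_
      rw [h] at hdig
      simp at hdig
    have hrev := (congrArg List.reverse hdig).trans (List.reverse_reverse _)
    exact ⟨⟨⟨_, hpos⟩, hA ⟨_, hmem, hrev⟩⟩, hrev⟩
  choose f hf using hcode
  have hinj : Function.Injective f := fun l m hlm => by
    have h := (hf l).symm.trans (hlm ▸ hf m)
    refine List.map_injective_iff.2 Subtype.val_injective
      (flatten_injOn_of_prefixFree (B := (B : Set (List ℕ))) (by simpa using hBnil)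
        (by simpa using hBprefix) ?_ ?_ (List.cons_injective h)) <;>
    · intro w hw
      obtain ⟨b, -, rfl⟩ := List.mem_map.1 hw
      exact b.2
  have hk0 : ((k : ℝ≥0∞) ^ (-s)) ≠ 0 := by
    simp only [ne_eq, ENNReal.rpow_eq_zero_iff, not_or, not_and]
    exact ⟨fun h => absurd h (by simp; omega), fun h => absurd h (ENNReal.natCast_ne_top k)⟩
  rw [← ENNReal.tsum_pow_lt_top_iff, ← ENNReal.tsum_pow_length_flatten]
  have hle : (k : ℝ≥0∞) ^ (-s) *
      ∑' l : List B, ((k : ℝ≥0∞) ^ (-s)) ^ (l.map Subtype.val).flatten.length < ⊤ := by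
    refine lt_of_le_of_lt ?_ hs
    rw [← ENNReal.tsum_mul_left]
    refine le_trans (ENNReal.tsum_le_tsum fun l => ?_)
      (ENNReal.tsum_comp_le_tsum_of_injective hinj _)
    rw [← pow_succ']
    exact le_rpow_neg_of_le_pow hs0
      (pow_length_le_and_le_of_reverse_digits_eq hk (hf l)).2
  exact ENNReal.lt_top_of_mul_ne_top_right hle.ne hk0


/-- Strings over the alphabet `Σ = {0, 1, …, k−1}` are modelled as lists of natural
numbers `< k`, written with the most significant symbol first; `(Nat.digits k n).reverse`
is the base-`k` expansion `rep_k(n)` of `n` (no leading zeroes).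

If `Δ` is a nonempty subset of `Σ − {0}`, `B ⊆ Σ*` is a finite instantaneous code
(nonempty, prefix-free, not containing the empty string), and
`A = { n ∈ ℤ⁺ : rep_k(n) ∈ ΔB* }`, then `Dim_ζ(A)` is the unique solution `s*` of
`Σ_{w ∈ B} k^{−s*·|w|} = 1`. -/
theorem zetaDim_instantaneous_code (k : ℕ) (hk : 2 ≤ k)
    (Δ : Finset ℕ) (hΔne : Δ.Nonempty) (hΔ : ∀ a ∈ Δ, a ≠ 0 ∧ a < k)
    (B : Finset (List ℕ)) (hBsig : ∀ w ∈ B, ∀ c ∈ w, c < k)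
    (hBne : B.Nonempty) (hBnil : [] ∉ B)
    (hBprefix : ∀ u ∈ B, ∀ v ∈ B, u <+: v → u = v)
    (A : Set ℕ+)
    (hA : A = {n : ℕ+ | ∃ a ∈ Δ, ∃ ws : List (List ℕ),
      (∀ w ∈ ws, w ∈ B) ∧ (Nat.digits k (n : ℕ)).reverse = a :: ws.flatten})
    (sstar : ℝ) (hs : ∑ w ∈ B, (k : ℝ) ^ (-(sstar * (w.length : ℝ))) = 1) :
    zetaDim A = sstar := by
  have hanti := strictAnti_sum_rpow_neg_length k hk B hBne hBnil
  have hsum : ∀ s : ℝ, ∑ w ∈ B, ((k : ℝ≥0∞) ^ (-s)) ^ w.length < 1 ↔ sstar < s := by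
    intro s
    rw [sum_rpow_neg_pow_length k (by omega), ENNReal.ofReal_lt_one, ← hs]
    exact hanti.lt_iff_gt
  have hs0 : 0 ≤ sstar := by
    by_contra! h
    have h1 := hanti h
    simp only [hs, zero_mul, neg_zero, Real.rpow_zero, Finset.sum_const, nsmul_eq_mul,
      mul_one] at h1
    exact absurd hBne.card_pos (by exact_mod_cast (Nat.cast_lt_one.1 h1).not_gt)
  have hset : {s : ℝ | 0 ≤ s ∧ (∑' n : A, (((n : ℕ+) : ℕ) : ENNReal) ^ (-s)) < ⊤}
      = Set.Ioi sstar := by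
    obtain ⟨a, ha⟩ := hΔne
    ext s
    refine ⟨fun ⟨h0, h⟩ => (hsum s).1 ?_, fun h => ?_⟩
    · exact sum_pow_length_lt_one_of_tsum_lt_top hk (hΔ a ha).1 (hΔ a ha).2 B hBsig hBnil
        hBprefix (hA ▸ fun n ⟨ws, h⟩ => ⟨a, ha, ws, h⟩) h0 h
    · have h0 : 0 ≤ s := hs0.trans (le_of_lt h)
      exact ⟨h0, tsum_rpow_neg_lt_top hk Δ B hA.subset h0 ((hsum s).2 h)⟩
  rw [zetaDim, hset, csInf_Ioi]
end

section
/- Kraft's inequality for supergales: let s > 0 and let d be an s-supergale. Then for every k ∈ ℕ, the number of binary strings w of length k with d(w) ≥ 1 is at most 2^{sk}·d(λ), where λ is the empty string. -/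
/-- Kraft's inequality for supergales: if `s > 0` and `d` is an `s`-supergale (a
nonnegative function on binary strings with `d(w) ≥ 2^{−s}[d(w0) + d(w1)]`), then for
every `k` the number of binary strings `w` of length `k` with `d(w) ≥ 1` is at most
`2^{sk}·d(λ)`. -/
theorem kraft_inequality_supergale (s : ℝ) (hs : 0 < s) (d : List Bool → ℝ)
    (hnn : ∀ w, 0 ≤ d w)
    (hgale : ∀ w, (2 : ℝ) ^ (-s) * (d (w ++ [false]) + d (w ++ [true])) ≤ d w)
    (k : ℕ) :
    (Set.ncard {w : List Bool | w.length = k ∧ 1 ≤ d w} : ℝ) ≤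
      (2 : ℝ) ^ (s * k) * d [] := by
  induction k generalizing d with
  | zero =>
    have hsub : {w : List Bool | w.length = 0 ∧ 1 ≤ d w} ⊆ {[]} := fun w hw =>
      List.length_eq_zero_iff.mp hw.1
    by_cases h : 1 ≤ d []
    · have hcard := Set.ncard_le_ncard hsub (Set.finite_singleton _)
      rw [Set.ncard_singleton] at hcard
      have hcard' : (Set.ncard {w : List Bool | w.length = 0 ∧ 1 ≤ d w} : ℝ) ≤ 1 := by
        exact_mod_cast hcard
      simpa using hcard'.trans h
    · have hempty : {w : List Bool | w.length = 0 ∧ 1 ≤ d w} = ∅ := by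
        refine Set.eq_empty_of_forall_notMem fun w hw => h ?_
        rw [← hsub hw]
        exact hw.2
      rw [hempty]
      simpa using hnn []
  | succ k ih =>
    have hsplit : {w : List Bool | w.length = k + 1 ∧ 1 ≤ d w} =
        List.cons false '' {w | w.length = k ∧ 1 ≤ d (false :: w)} ∪
          List.cons true '' {w | w.length = k ∧ 1 ≤ d (true :: w)} := by
      ext w
      rcases w with _ | ⟨_ | _, w⟩ <;> simp
    have hcard := Set.ncard_union_le
      (List.cons false '' {w | w.length = k ∧ 1 ≤ d (false :: w)})
      (List.cons true '' {w | w.length = k ∧ 1 ≤ d (true :: w)})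
    rw [← hsplit, Set.ncard_image_of_injective _ List.cons_injective,
      Set.ncard_image_of_injective _ List.cons_injective] at hcard
    have hsuffix (b : Bool) := ih (fun w => d (b :: w)) (fun w => hnn (b :: w))
      (fun w => hgale (b :: w))
    have hroot : d [false] + d [true] ≤ (2 : ℝ) ^ s * d [] := by
      have h := hgale []
      rwa [Real.rpow_neg zero_le_two, inv_mul_le_iff₀ (by positivity)] at h
    calc (Set.ncard {w : List Bool | w.length = k + 1 ∧ 1 ≤ d w} : ℝ)
        ≤ Set.ncard {w | w.length = k ∧ 1 ≤ d (false :: w)} +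
            Set.ncard {w | w.length = k ∧ 1 ≤ d (true :: w)} := by exact_mod_cast hcard
      _ ≤ (2 : ℝ) ^ (s * k) * d [false] + (2 : ℝ) ^ (s * k) * d [true] :=
          add_le_add (hsuffix false) (hsuffix true)
      _ = (2 : ℝ) ^ (s * k) * (d [false] + d [true]) := by ring
      _ ≤ (2 : ℝ) ^ (s * k) * ((2 : ℝ) ^ s * d []) := by gcongr
      _ = (2 : ℝ) ^ (s * (k + 1 : ℕ)) * d [] := by
          rw [← mul_assoc, ← Real.rpow_add two_pos]
          push_cast
          ring_nf
end

section
/- If A, B ⊆ ℤ⁺ are nonempty, then Dim_ζ(A * B) = max{ Dim_ζ(A), Dim_ζ(B) } ≤ Dim_ζ(A + B) ≤ Dim_ζ(A) + Dim_ζ(B), where A + B = { a + b : a ∈ A, b ∈ B } and A * B = { a·b : a ∈ A, b ∈ B }. -/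
open scoped ENNReal NNReal

/-- The zeta series of `A` evaluated at `s`. -/
noncomputable def zetaSum (A : Set ℕ+) (s : ℝ) : ℝ≥0∞ :=
  ∑' n : A, (((n : ℕ+) : ℕ) : ℝ≥0∞) ^ (-s)

lemma ENNReal.rpow_neg_le_rpow_neg {x y : ℝ≥0∞} {s : ℝ} (hs : 0 ≤ s) (h : x ≤ y) :
    y ^ (-s) ≤ x ^ (-s) := by
  rw [ENNReal.rpow_neg, ENNReal.rpow_neg]
  exact ENNReal.inv_le_inv.2 (ENNReal.rpow_le_rpow h hs)

lemma PNat.one_le_cast_ennreal (n : ℕ+) : (1 : ℝ≥0∞) ≤ ((n : ℕ) : ℝ≥0∞) := by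
  exact_mod_cast (one_le : 1 ≤ n)

lemma zetaSum_anti (A : Set ℕ+) {s t : ℝ} (h : s ≤ t) : zetaSum A t ≤ zetaSum A s :=
  ENNReal.tsum_le_tsum fun n =>
    ENNReal.rpow_le_rpow_of_exponent_le (PNat.one_le_cast_ennreal n) (neg_le_neg h)

lemma PNat.summable_rpow_neg_two (A : Set ℕ+) :
    Summable fun n : A => (((n : ℕ+) : ℕ) : ℝ≥0) ^ (-2 : ℝ) := by
  have hinj : Function.Injective fun n : A => ((n : ℕ+) : ℕ) := fun _ _ h =>
    Subtype.ext (PNat.eq h)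
  have hlt : (-2 : ℝ) < -1 := by norm_num
  exact NNReal.summable_comp_injective (NNReal.summable_rpow.2 hlt) hinj

lemma zetaSum_two_eq (A : Set ℕ+) :
    zetaSum A 2 = ∑' n : A, (((((n : ℕ+) : ℕ) : ℝ≥0) ^ (-2 : ℝ) : ℝ≥0) : ℝ≥0∞) := by
  refine tsum_congr fun n => ?_
  have hn : (((n : ℕ+) : ℕ) : ℝ≥0) ≠ 0 := Nat.cast_ne_zero.2 (n : ℕ+).ne_zero
  rw [ENNReal.coe_rpow_of_ne_zero hn, ENNReal.coe_natCast]

lemma zetaSum_two_lt_top (A : Set ℕ+) : zetaSum A 2 < ⊤ := by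
  rw [zetaSum_two_eq, lt_top_iff_ne_top]
  exact ENNReal.tsum_coe_ne_top_iff_summable.2 (PNat.summable_rpow_neg_two A)

lemma zetaDim_nonneg (A : Set ℕ+) : 0 ≤ zetaDim A :=
  Real.sInf_nonneg fun _ hs => hs.1

lemma zetaDim_le {A : Set ℕ+} {s : ℝ} (hs : 0 ≤ s) (h : zetaSum A s < ⊤) : zetaDim A ≤ s :=
  csInf_le ⟨0, fun _ ht => ht.1⟩ ⟨hs, h⟩

lemma zetaSum_lt_top {A : Set ℕ+} {s : ℝ} (h : zetaDim A < s) : zetaSum A s < ⊤ := by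
  rw [zetaDim] at h
  obtain ⟨t, ht, hts⟩ := exists_lt_of_csInf_lt (by exact ⟨2, zero_le_two, zetaSum_two_lt_top A⟩) h
  exact (zetaSum_anti A hts.le).trans_lt ht.2

lemma zetaDim_le_of_injective {A C : Set ℕ+} (f : ℕ+ → ℕ+) (hf : Function.Injective f)
    (hAC : ∀ a ∈ A, f a ∈ C) (K : ℕ+) (hK : ∀ a, f a ≤ K * a) : zetaDim A ≤ zetaDim C := by
  refine le_of_forall_gt_imp_ge_of_dense fun s hs => ?_
  have hs0 : 0 ≤ s := (zetaDim_nonneg C).trans hs.le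
  refine zetaDim_le hs0 ?_
  have hK0 : ((K : ℕ) : ℝ≥0∞) ^ (-s) ≠ 0 := by
    simp [ENNReal.rpow_eq_zero_iff]
  have key : ((K : ℕ) : ℝ≥0∞) ^ (-s) * zetaSum A s ≤ zetaSum C s := by
    rw [zetaSum, ← ENNReal.tsum_mul_left]
    have hinj : Function.Injective fun a : A => (⟨f a, hAC a a.2⟩ : C) := fun a b hab =>
      Subtype.ext (hf (congrArg Subtype.val hab))
    refine le_trans (ENNReal.tsum_le_tsum fun a => ?_)
      (ENNReal.tsum_comp_le_tsum_of_injective hinj _)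
    rw [← ENNReal.mul_rpow_of_ne_top (ENNReal.natCast_ne_top _) (ENNReal.natCast_ne_top _)]
    exact ENNReal.rpow_neg_le_rpow_neg hs0 (by exact_mod_cast hK a)
  refine lt_top_iff_ne_top.2 fun htop => ?_
  rw [htop, ENNReal.mul_top hK0] at key
  exact key.not_gt (zetaSum_lt_top hs)

lemma zetaSum_image2_le (f : ℕ+ → ℕ+ → ℕ+) (A B : Set ℕ+) {s t u : ℝ}
    (h : ∀ a b : ℕ+, ((f a b : ℕ) : ℝ≥0∞) ^ (-u) ≤
      ((a : ℕ) : ℝ≥0∞) ^ (-s) * ((b : ℕ) : ℝ≥0∞) ^ (-t)) :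
    zetaSum (Set.image2 f A B) u ≤ zetaSum A s * zetaSum B t := by
  let g : A × B → Set.image2 f A B := fun p => ⟨f p.1 p.2, Set.mem_image2_of_mem p.1.2 p.2.2⟩
  have hg : Function.Surjective g := by
    rintro ⟨_, a, ha, b, hb, rfl⟩
    exact ⟨(⟨a, ha⟩, ⟨b, hb⟩), rfl⟩
  calc zetaSum (Set.image2 f A B) u
      ≤ ∑' p : A × B, ((f p.1 p.2 : ℕ) : ℝ≥0∞) ^ (-u) :=
        ENNReal.tsum_le_tsum_comp_of_surjective hg _
    _ ≤ ∑' p : A × B, (((p.1 : ℕ+) : ℕ) : ℝ≥0∞) ^ (-s) * (((p.2 : ℕ+) : ℕ) : ℝ≥0∞) ^ (-t) :=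
        ENNReal.tsum_le_tsum fun p => h p.1 p.2
    _ = zetaSum A s * zetaSum B t := by
        rw [ENNReal.tsum_prod (f := fun (a : A) (b : B) =>
          (((a : ℕ+) : ℕ) : ℝ≥0∞) ^ (-s) * (((b : ℕ+) : ℕ) : ℝ≥0∞) ^ (-t))]
        simp only [ENNReal.tsum_mul_left, ENNReal.tsum_mul_right, zetaSum]

lemma zetaDim_image2_mul_le (A B : Set ℕ+) :
    zetaDim (Set.image2 (fun a b : ℕ+ => a * b) A B) ≤ max (zetaDim A) (zetaDim B) := by
  refine le_of_forall_gt_imp_ge_of_dense fun s hs => ?_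
  obtain ⟨hA, hB⟩ := max_lt_iff.1 hs
  refine zetaDim_le ((zetaDim_nonneg A).trans hA.le) ((zetaSum_image2_le _ A B fun a b => ?_).trans_lt
    (ENNReal.mul_lt_top (zetaSum_lt_top hA) (zetaSum_lt_top hB)))
  rw [← ENNReal.mul_rpow_of_ne_top (ENNReal.natCast_ne_top _) (ENNReal.natCast_ne_top _),
    PNat.mul_coe, Nat.cast_mul]

lemma zetaDim_image2_add_le (A B : Set ℕ+) :
    zetaDim (Set.image2 (fun a b : ℕ+ => a + b) A B) ≤ zetaDim A + zetaDim B := by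
  refine le_of_forall_gt_imp_ge_of_dense fun u hu => ?_
  obtain ⟨s, hA, t, hB, rfl⟩ : ∃ s, zetaDim A < s ∧ ∃ t, zetaDim B < t ∧ s + t = u :=
    ⟨(zetaDim A + (u - zetaDim B)) / 2, by linarith, (zetaDim B + (u - zetaDim A)) / 2,
      by linarith, by ring⟩
  have hs := (zetaDim_nonneg A).trans hA.le
  have ht := (zetaDim_nonneg B).trans hB.le
  refine zetaDim_le (add_nonneg hs ht) ((zetaSum_image2_le _ A B fun a b => ?_).trans_lt
    (ENNReal.mul_lt_top (zetaSum_lt_top hA) (zetaSum_lt_top hB)))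
  rw [neg_add, ENNReal.rpow_add _ _ (by simp) (ENNReal.natCast_ne_top _)]
  exact mul_le_mul' (ENNReal.rpow_neg_le_rpow_neg hs (by simp))
    (ENNReal.rpow_neg_le_rpow_neg ht (by simp))

lemma PNat.add_le_one_add_mul (a b : ℕ+) : a + b ≤ (1 + b) * a := by
  rw [add_mul, one_mul]
  gcongr
  exact le_mul_of_one_le_right' one_le

/-- For nonempty `A, B ⊆ ℤ⁺`:
`Dim_ζ(A*B) = max{Dim_ζ(A), Dim_ζ(B)} ≤ Dim_ζ(A+B) ≤ Dim_ζ(A) + Dim_ζ(B)`,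
where `A+B` and `A*B` are the pointwise sum and product. -/
theorem zetaDim_sum_product (A B : Set ℕ+) (hA : A.Nonempty) (hB : B.Nonempty) :
    zetaDim (Set.image2 (fun a b : ℕ+ => a * b) A B) = max (zetaDim A) (zetaDim B) ∧
      max (zetaDim A) (zetaDim B) ≤ zetaDim (Set.image2 (fun a b : ℕ+ => a + b) A B) ∧
      zetaDim (Set.image2 (fun a b : ℕ+ => a + b) A B) ≤ zetaDim A + zetaDim B := by
  obtain ⟨a, ha⟩ := hA
  obtain ⟨b, hb⟩ := hB
  refine ⟨le_antisymm (zetaDim_image2_mul_le A B) (max_le ?_ ?_), max_le ?_ ?_,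
    zetaDim_image2_add_le A B⟩
  · exact zetaDim_le_of_injective (· * b) (mul_left_injective b)
      (fun x hx => Set.mem_image2_of_mem hx hb) b fun x => (mul_comm x b).le
  · exact zetaDim_le_of_injective (a * ·) (mul_right_injective a)
      (fun x hx => Set.mem_image2_of_mem ha hx) a fun x => le_rfl
  · exact zetaDim_le_of_injective (· + b) (add_left_injective b)
      (fun x hx => Set.mem_image2_of_mem hx hb) (1 + b) fun x => PNat.add_le_one_add_mul x b
  · exact zetaDim_le_of_injective (a + ·) (add_right_injective a)
      (fun x hx => Set.mem_image2_of_mem ha hx) (1 + a) fun x =>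
        (add_comm a x).le.trans (PNat.add_le_one_add_mul x a)
end

section
/- For all α, β, γ ∈ [0,1] with α < β ≤ γ ≤ min{1, α + β}, there exist sets A, B ⊆ ℤ⁺ such that Dim_ζ(A) = α, Dim_ζ(B) = β, and Dim_ζ(A + B) = γ, where A + B = { a + b : a ∈ A, b ∈ B }. -/
/-- A super-exponentially growing sequence of scales. -/
def scale (m : ℕ) : ℕ := 2 ^ m.factorial

lemma scale_pos (m : ℕ) : 0 < scale m := by unfold scale; positivity

lemma scale_succ (m : ℕ) : scale (m + 1) = scale m ^ (m + 1) := by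
  rw [scale, scale, Nat.factorial_succ, ← pow_mul, mul_comm]

lemma two_pow_le_scale (m : ℕ) : 2 ^ m ≤ scale m :=
  Nat.pow_le_pow_right (by norm_num) m.self_le_factorial

lemma scale_mono : Monotone scale := fun _ _ h =>
  Nat.pow_le_pow_right (by norm_num) (Nat.factorial_le h)

lemma summable_scale {C d s : ℝ} (hds : d < s) :
    Summable fun m : ℕ =>
      C * scale m * (scale (m + 1) : ℝ) ^ d * (scale (m + 1) : ℝ) ^ (-s) := by
  have key : Summable fun m : ℕ =>
      (scale m : ℝ) * (scale (m + 1) : ℝ) ^ d * (scale (m + 1) : ℝ) ^ (-s) := by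
    have hg : Summable fun m : ℕ => ((1 : ℝ) / 2) ^ m := summable_geometric_two
    refine hg.of_norm_bounded_eventually_nat ?_
    obtain ⟨M, hM⟩ := exists_nat_gt (2 / (s - d))
    filter_upwards [Filter.eventually_ge_atTop M] with m hm
    have hs : 0 < s - d := by linarith
    have hp : (0 : ℝ) < scale m := by exact_mod_cast scale_pos m
    have hp1 : (1 : ℝ) ≤ scale m := by exact_mod_cast scale_pos m
    have h2 : 2 ≤ ((m : ℝ) + 1) * (s - d) := by
      rw [div_lt_iff₀ hs] at hM
      have : (M : ℝ) ≤ m := by exact_mod_cast hm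
      nlinarith
    rw [Real.norm_of_nonneg (by positivity), scale_succ, Nat.cast_pow, ← Real.rpow_natCast,
      ← Real.rpow_mul hp.le, ← Real.rpow_mul hp.le]
    nth_rewrite 1 [← Real.rpow_one (scale m : ℝ)]
    rw [← Real.rpow_add hp, ← Real.rpow_add hp]
    calc (scale m : ℝ) ^ (1 + ((m + 1 : ℕ) : ℝ) * d + ((m + 1 : ℕ) : ℝ) * -s)
        ≤ (scale m : ℝ) ^ (-1 : ℝ) := by
          apply Real.rpow_le_rpow_of_exponent_le hp1
          push_cast
          linarith
      _ = (scale m : ℝ)⁻¹ := Real.rpow_neg_one _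
      _ ≤ ((2 : ℝ) ^ m)⁻¹ := by
          gcongr
          exact_mod_cast two_pow_le_scale m
      _ = (1 / 2) ^ m := by simp
  simpa [mul_assoc] using key.mul_left C

lemma natCast_rpow_neg_anti {a b : ℕ} {s : ℝ} (hs : 0 ≤ s) (hab : a ≤ b) :
    (b : ENNReal) ^ (-s) ≤ (a : ENNReal) ^ (-s) := by
  rw [ENNReal.rpow_neg, ENNReal.rpow_neg]
  gcongr

lemma tsum_rpow_lt_top_of_cover {S : Set ℕ+} {C d s : ℝ} (hd : 0 ≤ d) (hds : d < s)
    (F : ℕ → Finset ℕ) (hF : ∀ n ∈ S, ∃ m, (n : ℕ) ∈ F m ∧ scale (m + 1) ≤ n)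
    (hcard : ∀ m, ((F m).card : ℝ) ≤ C * scale m * (scale (m + 1) : ℝ) ^ d) :
    (∑' n : S, (((n : ℕ+) : ℕ) : ENNReal) ^ (-s)) < ⊤ := by
  let t : ℕ → Set ℕ+ := fun m => {n | (n : ℕ) ∈ F m ∧ scale (m + 1) ≤ n}
  have hS : S ⊆ ⋃ m, t m := fun n hn => Set.mem_iUnion.2 (hF n hn)
  let f : ℕ+ → ENNReal := fun n => ((n : ℕ) : ENNReal) ^ (-s)
  have hblock : ∀ m, ∑' n : t m, f n ≤ ENNReal.ofReal
      (C * scale m * (scale (m + 1) : ℝ) ^ d * (scale (m + 1) : ℝ) ^ (-s)) := by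
    intro m
    have hp : (0 : ℝ) < scale (m + 1) := by exact_mod_cast scale_pos _
    have hcount : (t m).encard ≤ (F m).card := by
      rw [← PNat.coe_injective.encard_image, ← Set.encard_coe_eq_coe_finsetCard]
      apply Set.encard_le_encard
      rintro _ ⟨n, hn, rfl⟩
      exact hn.1
    calc ∑' n : t m, f n ≤ ∑' _ : t m, (scale (m + 1) : ENNReal) ^ (-s) := by
          refine ENNReal.tsum_le_tsum fun n => ?_
          apply natCast_rpow_neg_anti (by linarith)
          exact n.2.2
      _ = (t m).encard * (scale (m + 1) : ENNReal) ^ (-s) := ENNReal.tsum_set_const _ _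
      _ ≤ ((F m).card : ENNReal) * (scale (m + 1) : ENNReal) ^ (-s) := by
          gcongr
          exact_mod_cast hcount
      _ = ENNReal.ofReal ((F m).card * (scale (m + 1) : ℝ) ^ (-s)) := by
          rw [ENNReal.ofReal_mul (by positivity), ← ENNReal.ofReal_rpow_of_pos hp,
            ENNReal.ofReal_natCast, ENNReal.ofReal_natCast]
      _ ≤ _ := by
          apply ENNReal.ofReal_le_ofReal
          gcongr
          exact hcard m
  calc (∑' n : S, f n) ≤ ∑' n : ⋃ m, t m, f n := ENNReal.tsum_mono_subtype f hS
    _ ≤ ∑' m, ∑' n : t m, f n := ENNReal.tsum_iUnion_le_tsum f t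
    _ ≤ ∑' m, ENNReal.ofReal _ := ENNReal.tsum_le_tsum hblock
    _ < ⊤ := (summable_scale hds).tsum_ofReal_lt_top

lemma le_of_tsum_rpow_lt_top {S : Set ℕ+} {c d s : ℝ} (hc : 0 < c) (hs : 0 ≤ s)
    (T : ℕ → Finset ℕ) (hT : ∀ m, ∀ t ∈ T m, t ≤ 4 * scale (m + 1) ∧ ∃ n ∈ S, (n : ℕ) = t)
    (hcard : ∀ m, c * (scale (m + 1) : ℝ) ^ d ≤ (T m).card)
    (hfin : (∑' n : S, (((n : ℕ+) : ℕ) : ENNReal) ^ (-s)) < ⊤) : d ≤ s := by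
  by_contra! hsd
  let f : ℕ+ → ENNReal := fun n => ((n : ℕ) : ENNReal) ^ (-s)
  set K := ∑' n : S, f n
  have hbound : ∀ m, c * 4 ^ (-s) * (scale (m + 1) : ℝ) ^ (d - s) ≤ K.toReal := by
    intro m
    have hp : (0 : ℝ) < scale (m + 1) := by exact_mod_cast scale_pos _
    let U : Set ℕ+ := {n | n ∈ S ∧ (n : ℕ) ∈ T m}
    have hcount : ((T m).card : ENat) ≤ U.encard := by
      rw [← PNat.coe_injective.encard_image, ← Set.encard_coe_eq_coe_finsetCard]
      apply Set.encard_le_encard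
      intro t ht
      obtain ⟨n, hn, rfl⟩ := (hT m t ht).2
      exact ⟨n, ⟨hn, ht⟩, rfl⟩
    have hle : ENNReal.ofReal ((T m).card * (4 * scale (m + 1) : ℝ) ^ (-s)) ≤ K := by
      calc ENNReal.ofReal ((T m).card * (4 * scale (m + 1) : ℝ) ^ (-s))
          = ((T m).card : ENNReal) * ((4 * scale (m + 1) : ℕ) : ENNReal) ^ (-s) := by
            rw [ENNReal.ofReal_mul (by positivity), ← ENNReal.ofReal_rpow_of_pos (by positivity),
              ENNReal.ofReal_natCast, ← ENNReal.ofReal_natCast (4 * scale (m + 1))]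
            push_cast
            rfl
        _ ≤ U.encard * ((4 * scale (m + 1) : ℕ) : ENNReal) ^ (-s) := by
            gcongr
            exact_mod_cast hcount
        _ = ∑' _ : U, ((4 * scale (m + 1) : ℕ) : ENNReal) ^ (-s) :=
            (ENNReal.tsum_set_const _ _).symm
        _ ≤ ∑' n : U, f n := by
            refine ENNReal.tsum_le_tsum fun n => ?_
            apply natCast_rpow_neg_anti (by linarith)
            exact (hT m _ n.2.2).1
        _ ≤ K := ENNReal.tsum_mono_subtype f fun n hn => hn.1
    rw [ENNReal.ofReal_le_iff_le_toReal hfin.ne] at hle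
    refine le_trans ?_ hle
    rw [Real.mul_rpow (by norm_num) hp.le, sub_eq_add_neg, Real.rpow_add hp]
    calc c * 4 ^ (-s) * ((scale (m + 1) : ℝ) ^ d * (scale (m + 1) : ℝ) ^ (-s))
        = (c * (scale (m + 1) : ℝ) ^ d) * (4 ^ (-s) * (scale (m + 1) : ℝ) ^ (-s)) := by ring
      _ ≤ _ := by
        gcongr
        exact hcard m
  have hscale : Filter.Tendsto (fun m => (scale (m + 1) : ℝ)) Filter.atTop Filter.atTop := by
    refine Filter.tendsto_atTop_mono (fun m => ?_) tendsto_natCast_atTop_atTop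
    exact_mod_cast (Nat.lt_two_pow_self.le.trans (two_pow_le_scale m)).trans
      (scale_mono m.le_succ)
  have hlim := ((tendsto_rpow_atTop (sub_pos.2 hsd)).comp hscale).const_mul_atTop
    (show 0 < c * (4 : ℝ) ^ (-s) by positivity)
  obtain ⟨m, hm⟩ := (hlim.eventually_gt_atTop K.toReal).exists
  exact (hbound m).not_gt hm

lemma zetaDim_eq_of_counting {S : Set ℕ+} {C c d : ℝ} (hd : 0 ≤ d) (hc : 0 < c)
    (F : ℕ → Finset ℕ) (hF : ∀ n ∈ S, ∃ m, (n : ℕ) ∈ F m ∧ scale (m + 1) ≤ n)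
    (hFcard : ∀ m, ((F m).card : ℝ) ≤ C * scale m * (scale (m + 1) : ℝ) ^ d)
    (T : ℕ → Finset ℕ) (hT : ∀ m, ∀ t ∈ T m, t ≤ 4 * scale (m + 1) ∧ ∃ n ∈ S, (n : ℕ) = t)
    (hTcard : ∀ m, c * (scale (m + 1) : ℝ) ^ d ≤ (T m).card) :
    zetaDim S = d := by
  have hmem : ∀ s, d < s →
      s ∈ {s : ℝ | 0 ≤ s ∧ (∑' n : S, (((n : ℕ+) : ℕ) : ENNReal) ^ (-s)) < ⊤} := fun s hs =>
    ⟨hd.trans hs.le, tsum_rpow_lt_top_of_cover hd hs F hF hFcard⟩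
  apply le_antisymm
  · exact le_of_forall_gt_imp_ge_of_dense fun s hs => csInf_le ⟨0, fun _ h => h.1⟩ (hmem s hs)
  · exact le_csInf ⟨d + 1, hmem _ (by linarith)⟩ fun s hs =>
      le_of_tsum_rpow_lt_top hc hs.1 T hT hTcard hs.2

/-- `⌊N_m ^ x⌋`, where `N_m = scale (m + 1)`. -/
noncomputable def scalePow (x : ℝ) (m : ℕ) : ℕ := ⌊(scale (m + 1) : ℝ) ^ x⌋₊

lemma one_le_scale_rpow {x : ℝ} (hx : 0 ≤ x) (m : ℕ) : 1 ≤ (scale (m + 1) : ℝ) ^ x :=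
  Real.one_le_rpow (by exact_mod_cast scale_pos _) hx

lemma one_le_scalePow {x : ℝ} (hx : 0 ≤ x) (m : ℕ) : 1 ≤ scalePow x m :=
  Nat.le_floor (by exact_mod_cast one_le_scale_rpow hx m)

lemma scale_rpow_mono {x y : ℝ} (hxy : x ≤ y) (m : ℕ) :
    (scale (m + 1) : ℝ) ^ x ≤ (scale (m + 1) : ℝ) ^ y :=
  Real.rpow_le_rpow_of_exponent_le (by exact_mod_cast scale_pos _) hxy

lemma scalePow_mono {x y : ℝ} (hxy : x ≤ y) (m : ℕ) : scalePow x m ≤ scalePow y m :=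
  Nat.floor_mono (scale_rpow_mono hxy m)

lemma scalePow_le (x : ℝ) (m : ℕ) : (scalePow x m : ℝ) ≤ (scale (m + 1) : ℝ) ^ x :=
  Nat.floor_le (by positivity)

lemma half_scale_rpow_le {x : ℝ} (hx : 0 ≤ x) (m : ℕ) :
    (scale (m + 1) : ℝ) ^ x / 2 ≤ scalePow x m := by
  have h1 : (1 : ℝ) ≤ scalePow x m := by exact_mod_cast one_le_scalePow hx m
  have h2 : (scale (m + 1) : ℝ) ^ x < scalePow x m + 1 := Nat.lt_floor_add_one _
  linarith

lemma scalePow_mul_le (x y : ℝ) (m : ℕ) :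
    (scalePow x m * scalePow y m : ℝ) ≤ (scale (m + 1) : ℝ) ^ (x + y) := by
  rw [Real.rpow_add (by exact_mod_cast scale_pos _)]
  gcongr <;> exact scalePow_le _ _

lemma quarter_scale_rpow_le {x y : ℝ} (hx : 0 ≤ x) (hy : 0 ≤ y) (m : ℕ) :
    (1 / 4) * (scale (m + 1) : ℝ) ^ (x + y) ≤ scalePow x m * scalePow y m := by
  rw [Real.rpow_add (by exact_mod_cast scale_pos _)]
  calc _ = ((scale (m + 1) : ℝ) ^ x / 2) * ((scale (m + 1) : ℝ) ^ y / 2) := by ring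
    _ ≤ _ := by gcongr <;> exact half_scale_rpow_le ‹_› m

/-- The arithmetic progression with difference `⌊N_m ^ e⌋`, starting at `N_m = scale (m + 1)` and
with `⌊N_m ^ d⌋ + 1` terms. -/
noncomputable def progression (e d : ℝ) (m : ℕ) : Finset ℕ :=
  (Finset.range (scalePow d m + 1)).image fun j => scale (m + 1) + scalePow e m * j

lemma mem_progression {e d : ℝ} {m n : ℕ} :
    n ∈ progression e d m ↔
      ∃ j ≤ scalePow d m, scale (m + 1) + scalePow e m * j = n := by
  simp [progression]

lemma scale_le_of_mem_progression {e d : ℝ} {m n : ℕ} (h : n ∈ progression e d m) :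
    scale (m + 1) ≤ n := by
  obtain ⟨j, -, rfl⟩ := mem_progression.1 h
  exact Nat.le_add_right _ _

lemma le_of_mem_progression {e d : ℝ} (h1 : e + d ≤ 1) {m n : ℕ}
    (h : n ∈ progression e d m) : n ≤ 2 * scale (m + 1) := by
  obtain ⟨j, hj, rfl⟩ := mem_progression.1 h
  have h2 := (scalePow_mul_le e d m).trans (scale_rpow_mono h1 m)
  rw [Real.rpow_one] at h2
  have h3 : scalePow e m * scalePow d m ≤ scale (m + 1) := by exact_mod_cast h2
  have := Nat.mul_le_mul_left (scalePow e m) hj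
  omega

lemma card_progression {e d : ℝ} (he : 0 ≤ e) (m : ℕ) :
    (progression e d m).card = scalePow d m + 1 := by
  rw [progression, Finset.card_image_of_injective, Finset.card_range]
  intro i j hij
  have := one_le_scalePow he m
  exact Nat.eq_of_mul_eq_mul_left this (Nat.add_left_cancel hij)

lemma card_progression_le {e d : ℝ} (he : 0 ≤ e) (hd : 0 ≤ d) (m : ℕ) :
    ((progression e d m).card : ℝ) ≤ 2 * (scale (m + 1) : ℝ) ^ d := by
  rw [card_progression he]
  push_cast
  linarith [scalePow_le d m, one_le_scale_rpow hd m]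

/-- The positive integers lying in one of the progressions `progression e d m`. -/
def progressionUnion (e d : ℝ) : Set ℕ+ := {n | ∃ m, (n : ℕ) ∈ progression e d m}

lemma exists_mem_progressionUnion {e d : ℝ} {m n : ℕ} (h : n ∈ progression e d m) :
    ∃ k ∈ progressionUnion e d, (k : ℕ) = n :=
  ⟨⟨n, (scale_pos _).trans_le (scale_le_of_mem_progression h)⟩, ⟨m, h⟩, rfl⟩

lemma zetaDim_progressionUnion {e d : ℝ} (he : 0 ≤ e) (hd : 0 ≤ d) (h1 : e + d ≤ 1) :
    zetaDim (progressionUnion e d) = d := by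
  refine zetaDim_eq_of_counting (C := 2) (c := 1 / 2) hd (by norm_num)
    (progression e d) ?_ ?_ (progression e d) ?_ ?_
  · rintro n ⟨m, hm⟩
    exact ⟨m, hm, scale_le_of_mem_progression hm⟩
  · intro m
    refine (card_progression_le he hd m).trans ?_
    have : (1 : ℝ) ≤ scale m := by exact_mod_cast scale_pos m
    gcongr
    linarith
  · intro m t ht
    exact ⟨(le_of_mem_progression h1 ht).trans (by omega), exists_mem_progressionUnion ht⟩
  · intro m
    rw [card_progression he]
    push_cast
    linarith [half_scale_rpow_le hd m]

/-- A finite set containing all sums `a + b` with `a ∈ progression 0 α j`, `b ∈ progression e β k`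
and `max j k = m`. -/
noncomputable def sumCover (α e β : ℝ) (m : ℕ) : Finset ℕ :=
  Finset.Icc (2 * scale (m + 1)) (2 * scale (m + 1) + (scalePow α m + scalePow e m * scalePow β m))
    ∪ (Finset.image₂ (· + ·) (progression 0 α m) (Finset.range (2 * scale m + 1))
      ∪ Finset.image₂ (· + ·) (Finset.range (2 * scale m + 1)) (progression e β m))

lemma scalePow_zero (m : ℕ) : scalePow 0 m = 1 := by simp [scalePow]

lemma exists_mem_sumCover {α e β : ℝ} (hα1 : α ≤ 1) (heβ : e + β ≤ 1) {j k a b : ℕ}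
    (ha : a ∈ progression 0 α j) (hb : b ∈ progression e β k) :
    ∃ m, a + b ∈ sumCover α e β m ∧ scale (m + 1) ≤ a + b := by
  have hak := scale_le_of_mem_progression ha
  have hbk := scale_le_of_mem_progression hb
  have hau := le_of_mem_progression (by linarith) ha
  have hbu := le_of_mem_progression heβ hb
  simp only [sumCover, Finset.mem_union]
  rcases lt_trichotomy j k with h | rfl | h
  · refine ⟨k, Or.inr (Or.inr (Finset.mem_image₂_of_mem ?_ hb)), by omega⟩
    have := scale_mono (Nat.succ_le_of_lt h)
    simp only [Nat.succ_eq_add_one] at this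
    simp only [Finset.mem_range]
    omega
  · refine ⟨j, Or.inl ?_, by omega⟩
    obtain ⟨x, hx, rfl⟩ := mem_progression.1 ha
    obtain ⟨y, hy, rfl⟩ := mem_progression.1 hb
    have := Nat.mul_le_mul_left (scalePow e j) hy
    rw [scalePow_zero, Finset.mem_Icc]
    constructor <;> omega
  · refine ⟨j, Or.inr (Or.inl (Finset.mem_image₂_of_mem ha ?_)), by omega⟩
    have := scale_mono (Nat.succ_le_of_lt h)
    simp only [Nat.succ_eq_add_one] at this
    simp only [Finset.mem_range]
    omega

lemma card_sumCover_le {α e β γ : ℝ} (hα : 0 ≤ α) (he : 0 ≤ e) (hβ : 0 ≤ β) (hαγ : α ≤ γ)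
    (heβ : e + β = γ) (m : ℕ) :
    ((sumCover α e β m).card : ℝ) ≤ 15 * scale m * (scale (m + 1) : ℝ) ^ γ := by
  have hγ : 0 ≤ γ := hα.trans hαγ
  have hP1 : (1 : ℝ) ≤ scale m := by exact_mod_cast scale_pos m
  set G := (scale (m + 1) : ℝ) ^ γ
  have hG1 : 1 ≤ G := one_le_scale_rpow hγ m
  have hA : ((progression 0 α m).card : ℝ) ≤ 2 * G :=
    (card_progression_le le_rfl hα m).trans (by gcongr; exact scale_rpow_mono hαγ m)
  have hB : ((progression e β m).card : ℝ) ≤ 2 * G :=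
    (card_progression_le he hβ m).trans (by gcongr; exact scale_rpow_mono (by linarith) m)
  have hIcc : (scalePow α m + scalePow e m * scalePow β m : ℝ) ≤ 2 * G := by
    have h1 := (scalePow_le α m).trans (scale_rpow_mono hαγ m)
    have h2 := scalePow_mul_le e β m
    rw [heβ] at h2
    linarith
  have hcard : (sumCover α e β m).card ≤
      (scalePow α m + scalePow e m * scalePow β m + 1) +
        ((progression 0 α m).card * (2 * scale m + 1) +
          (2 * scale m + 1) * (progression e β m).card) := by
    refine (Finset.card_union_le _ _).trans (add_le_add ?_ ((Finset.card_union_le _ _).trans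
      (add_le_add ?_ ?_)))
    · rw [Nat.card_Icc]
      omega
    · exact (Finset.card_image₂_le _ _ _).trans_eq (by rw [Finset.card_range])
    · exact (Finset.card_image₂_le _ _ _).trans_eq (by rw [Finset.card_range])
  have hcard' : ((sumCover α e β m).card : ℝ) ≤
      (scalePow α m + scalePow e m * scalePow β m + 1) +
        ((progression 0 α m).card * (2 * scale m + 1) +
          (2 * scale m + 1) * (progression e β m).card) := by
    exact_mod_cast hcard
  set P := (scale m : ℝ)
  have h1 : ((progression 0 α m).card : ℝ) * (2 * P + 1) ≤ 2 * G * (3 * P) := by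
    gcongr
    linarith
  have h2 : (2 * P + 1) * ((progression e β m).card : ℝ) ≤ 3 * P * (2 * G) := by
    gcongr
    linarith
  nlinarith

lemma add_mem_progressions {α e β : ℝ} (he : 0 ≤ e) (heα : e ≤ α) {m t : ℕ}
    (ht : t < scalePow e m * scalePow β m) :
    ∃ a ∈ progression 0 α m, ∃ b ∈ progression e β m, a + b = 2 * scale (m + 1) + t := by
  have hL := one_le_scalePow he m
  refine ⟨scale (m + 1) + scalePow 0 m * (t % scalePow e m),
    mem_progression.2 ⟨_, ?_, rfl⟩, scale (m + 1) + scalePow e m * (t / scalePow e m),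
    mem_progression.2 ⟨_, ?_, rfl⟩, ?_⟩
  · exact (Nat.mod_lt _ hL).le.trans (scalePow_mono heα m)
  · exact (Nat.div_lt_of_lt_mul ht).le
  · have := Nat.mod_add_div t (scalePow e m)
    rw [scalePow_zero]
    omega

lemma zetaDim_add_progressionUnion {α e β γ : ℝ} (hα : 0 ≤ α) (he : 0 ≤ e) (hβ : 0 ≤ β)
    (heα : e ≤ α) (hαγ : α ≤ γ) (heβ : e + β = γ) (hγ1 : γ ≤ 1) :
    zetaDim (Set.image2 (fun a b : ℕ+ => a + b) (progressionUnion 0 α) (progressionUnion e β))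
      = γ := by
  refine zetaDim_eq_of_counting (C := 15) (c := 1 / 4) (hα.trans hαγ) (by norm_num)
    (sumCover α e β) ?_ (card_sumCover_le hα he hβ hαγ heβ)
    (fun m => (Finset.range (scalePow e m * scalePow β m)).image (2 * scale (m + 1) + ·)) ?_ ?_
  · rintro _ ⟨a, ⟨j, ha⟩, b, ⟨k, hb⟩, rfl⟩
    exact exists_mem_sumCover (hαγ.trans hγ1) (heβ.trans_le hγ1) ha hb
  · intro m t ht
    obtain ⟨i, hi, rfl⟩ := Finset.mem_image.1 ht
    obtain ⟨a, ha, b, hb, hab⟩ := add_mem_progressions he heα (Finset.mem_range.1 hi)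
    have hau := le_of_mem_progression (by linarith) ha
    have hbu := le_of_mem_progression (heβ.trans_le hγ1) hb
    obtain ⟨a, ha', rfl⟩ := exists_mem_progressionUnion ha
    obtain ⟨b, hb', rfl⟩ := exists_mem_progressionUnion hb
    exact ⟨by omega, a + b, ⟨a, ha', b, hb', rfl⟩, by simpa using hab⟩
  · intro m
    rw [Finset.card_image_of_injective _ (add_right_injective _), Finset.card_range, ← heβ]
    exact_mod_cast quarter_scale_rpow_le he hβ m

/-- For all `α, β, γ ∈ [0,1]` with `α < β ≤ γ ≤ min{1, α+β}`, there are `A, B ⊆ ℤ⁺`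
with `Dim_ζ(A) = α`, `Dim_ζ(B) = β`, and `Dim_ζ(A+B) = γ`. -/
theorem zetaDim_sum_realizable (α β γ : ℝ)
    (hα0 : 0 ≤ α) (hα1 : α ≤ 1) (hβ1 : β ≤ 1) (hγ1 : γ ≤ 1)
    (hαβ : α < β) (hβγ : β ≤ γ) (hγ : γ ≤ min 1 (α + β)) :
    ∃ A B : Set ℕ+, zetaDim A = α ∧ zetaDim B = β ∧
      zetaDim (Set.image2 (fun a b : ℕ+ => a + b) A B) = γ := by
  have hβ0 : 0 ≤ β := hα0.trans hαβ.le
  have he : 0 ≤ γ - β := sub_nonneg.2 hβγ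
  have heα : γ - β ≤ α := by linarith [hγ.trans (min_le_right _ _)]
  exact ⟨progressionUnion 0 α, progressionUnion (γ - β) β,
    zetaDim_progressionUnion le_rfl hα0 (by linarith),
    zetaDim_progressionUnion he hβ0 (by linarith),
    zetaDim_add_progressionUnion hα0 he hβ0 heα (hαβ.le.trans hβγ) (by ring) hγ1⟩
end
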